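/- Let M̂ = (p! M_p)_{p∈ℕ} be a sequence with M̂ ∈ LC, γ(ω_{M̂}) > 1, and M̂ of moderate growth: ∃C ≥ 1 ∀j,k ∈ ℕ: M̂_{j+k} ≤ C^{j+k} M̂_j M̂_k. Then for every γ with 0 < γ < min(2, γ(ω_{M̂}) − 1) and every h > 0 there exist h₁ > 0 and a continuous linear operator E : Λ¹_{M̂,h} → A_{M̂,h₁}(S_γ) such that for every λ ∈ Λ¹_{M̂,h} and every p ∈ ℕ, the p-th derivative of E(λ) tends to λ_p as z → 0 within S_γ. In particular the Borel map on the Roumieu class A_{{M̂}}(S_γ) = ∪_{h>0} A_{M̂,h}(S_γ) is surjective onto Λ¹_{{M̂}} = ∪_{h>0} Λ¹_{M̂,h}. -/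

import Mathlib

open Filter MeasureTheory Set Asymptotics

noncomputable section

/-- A *weight function*: continuous and nondecreasing on `[0,∞)`, vanishing at `0`,
and tending to `+∞` at `+∞`. -/
structure IsWeightFunction (ω : ℝ → ℝ) : Prop where
  continuousOn : ContinuousOn ω (Set.Ici 0)
  monotoneOn : MonotoneOn ω (Set.Ici 0)
  map_zero : ω 0 = 0
  tendsto_atTop : Filter.Tendsto ω Filter.atTop Filter.atTop

/-- Condition `(P_{ω,γ})`: there is `K > 1` with `limsup_{t→∞} ω(K^γ t)/ω(t) < K`,
expressed through an eventual bound by some `c < K`. -/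
def Pcond (ω : ℝ → ℝ) (γ : ℝ) : Prop :=
  ∃ K : ℝ, 1 < K ∧ ∃ c : ℝ, c < K ∧ ∀ᶠ t : ℝ in Filter.atTop, ω (K ^ γ * t) / ω t ≤ c

/-- The growth index `γ(ω) ∈ [0,+∞]`, with `sup ∅ = 0`. -/
noncomputable def gammaIndex (ω : ℝ → ℝ) : ENNReal :=
  ⨆ γ ∈ {γ : ℝ | 0 < γ ∧ Pcond ω γ}, ENNReal.ofReal γ

/-- Condition `(ω₁)`. -/
def Omega1 (ω : ℝ → ℝ) : Prop :=
  ∃ L : ℝ, 1 ≤ L ∧ ∀ t : ℝ, 0 ≤ t → ω (2 * t) ≤ L * (ω t + 1)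

/-- Condition `(ω₃)`: `log t = o(ω t)` as `t → ∞`. -/
def Omega3 (ω : ℝ → ℝ) : Prop :=
  (fun t : ℝ => Real.log t) =o[Filter.atTop] ω

/-- Condition `(ω₄)`: `t ↦ ω (exp t)` is convex on `ℝ`. -/
def Omega4 (ω : ℝ → ℝ) : Prop :=
  ConvexOn ℝ Set.univ (fun t : ℝ => ω (Real.exp t))

/-- Condition `(ω₅)`: `ω t = o(t)` as `t → ∞`. -/
def Omega5 (ω : ℝ → ℝ) : Prop :=
  ω =o[Filter.atTop] (fun t : ℝ => t)

/-- Condition `(ω_snq)`. -/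
def OmegaSnq (ω : ℝ → ℝ) : Prop :=
  ∃ C : ℝ, 0 < C ∧ ∀ y : ℝ, 0 < y →
    (∫⁻ t in Set.Ioi (1:ℝ), ENNReal.ofReal (ω (y * t) / t ^ 2)) ≤
      ENNReal.ofReal (C * (ω y + 1))

/-- `ω ∈ W₀`: normalized weight function with `(ω₃)` and `(ω₄)`. -/
def InW0 (ω : ℝ → ℝ) : Prop :=
  IsWeightFunction ω ∧ (∀ t ∈ Set.Icc (0:ℝ) 1, ω t = 0) ∧ Omega3 ω ∧ Omega4 ω

/-- The Legendre–Fenchel–Young conjugate `φ*_ω(x) = sup {x y − ω(e^y) : y ≥ 0}`. -/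
noncomputable def phiStar (ω : ℝ → ℝ) (x : ℝ) : ℝ :=
  sSup ((fun y : ℝ => x * y - ω (Real.exp y)) '' Set.Ici 0)

/-- The associated weight matrix `W^l_j = exp((1/l) φ*_ω(l j))`. -/
noncomputable def Wseq (ω : ℝ → ℝ) (l : ℝ) (j : ℕ) : ℝ :=
  Real.exp ((1 / l) * phiStar ω (l * (j : ℝ)))

/-- `w^l_j = W^l_j / j!`. -/
noncomputable def wseq (ω : ℝ → ℝ) (l : ℝ) (j : ℕ) : ℝ :=
  Wseq ω l j / (Nat.factorial j : ℝ)

/-- `h_M(t) = inf_{k ∈ ℕ} M_k t^k`. -/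
noncomputable def hFun (M : ℕ → ℝ) (t : ℝ) : ℝ :=
  ⨅ k : ℕ, M k * t ^ k

/-- The associated function `ω_M(t) = sup_p log (t^p / M_p)` for `t > 0`, `ω_M(0) = 0`. -/
noncomputable def assocWeight (M : ℕ → ℝ) (t : ℝ) : ℝ :=
  if t ≤ 0 then 0 else ⨆ p : ℕ, Real.log (t ^ p / M p)

/-- The upper Legendre conjugate `ω⋆(s) = sup_{t ≥ 0} (ω(t) − s t)`. -/
noncomputable def upperConj (ω : ℝ → ℝ) (s : ℝ) : ℝ :=
  sSup ((fun t : ℝ => ω t - s * t) '' Set.Ici 0)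

/-- `(ω⋆)^ι(t) = ω⋆(1/t)` for `t > 0`, with value `0` at `t = 0`. -/
noncomputable def upperConjIota (ω : ℝ → ℝ) (t : ℝ) : ℝ :=
  if t = 0 then 0 else upperConj ω (1 / t)

/-- The lower Legendre conjugate `(ω^ι)_⋆(t) = inf_{s > 0} (ω(1/s) + t s)`. -/
noncomputable def lowerConjIota (ω : ℝ → ℝ) (t : ℝ) : ℝ :=
  sInf ((fun s : ℝ => ω (1 / s) + t * s) '' Set.Ioi 0)

/-- The unbounded sector `S_γ ⊆ ℂ` of opening `γ π` bisected by direction `0`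
(for `0 < γ < 2` it lies in `ℂ`). -/
def sector (γ : ℝ) : Set ℂ :=
  {z : ℂ | z ≠ 0 ∧ |Complex.arg z| < γ * Real.pi / 2}

/-- `M ∈ LC`: positive, normalized, log-convex, `(M_p)^{1/p} → ∞`. -/
def LCseq (M : ℕ → ℝ) : Prop :=
  (∀ p, 0 < M p) ∧ M 0 = 1 ∧ M 0 ≤ M 1 ∧
  (∀ j : ℕ, 1 ≤ j → M j ^ 2 ≤ M (j - 1) * M (j + 1)) ∧
  Filter.Tendsto (fun p : ℕ => M p ^ ((1 : ℝ) / (p : ℝ))) Filter.atTop Filter.atTop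

/-- The partial derivative `∂_i` of a function on `ℝ^d`. -/
noncomputable def partialDeriv {d : ℕ} (i : Fin d)
    (f : EuclideanSpace ℝ (Fin d) → ℂ) : EuclideanSpace ℝ (Fin d) → ℂ :=
  fun x => fderiv ℝ f x (EuclideanSpace.single i 1)

/-- The iterated partial derivative `∂^j` for a multiindex `j ∈ ℕ^d`. -/
noncomputable def multiDeriv {d : ℕ} (j : Fin d → ℕ)
    (f : EuclideanSpace ℝ (Fin d) → ℂ) : EuclideanSpace ℝ (Fin d) → ℂ :=
  (List.finRange d).foldr (fun i g => (partialDeriv i)^[j i] g) f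

end


/-! ### Log-convex sequences and their associated function -/

lemma LCseq.pos {N : ℕ → ℝ} (hN : LCseq N) (p : ℕ) : 0 < N p := hN.1 p

lemma LCseq.quotient_pos {N : ℕ → ℝ} (hN : LCseq N) (k : ℕ) : 0 < N (k + 1) / N k :=
  div_pos (hN.pos _) (hN.pos _)

lemma LCseq.monotone_quotient {N : ℕ → ℝ} (hN : LCseq N) :
    Monotone fun k => N (k + 1) / N k := by
  refine monotone_nat_of_le_succ fun k => ?_
  rw [div_le_div_iff₀ (hN.pos _) (hN.pos _), ← sq]
  have := hN.2.2.2.1 (k + 1) (Nat.le_add_left 1 k)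
  rw [Nat.add_sub_cancel] at this
  linarith

lemma LCseq.mul_pow_le {N : ℕ → ℝ} (hN : LCseq N) (k n : ℕ) :
    N k * (N (k + 1) / N k) ^ n ≤ N (k + n) := by
  induction n with
  | zero => simp
  | succ n ih =>
    calc _ = N k * (N (k + 1) / N k) ^ n * (N (k + 1) / N k) := by ring
      _ ≤ N (k + n) * (N (k + n + 1) / N (k + n)) :=
          mul_le_mul ih (hN.monotone_quotient (Nat.le_add_right k n)) (hN.quotient_pos k).le
            (hN.pos _).le
      _ = _ := mul_div_cancel₀ _ (hN.pos _).ne'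

lemma LCseq.le_mul_pow {N : ℕ → ℝ} (hN : LCseq N) (p n k : ℕ) (hk : p + n ≤ k) :
    N (p + n) ≤ N p * (N (k + 1) / N k) ^ n := by
  induction n with
  | zero => simp
  | succ n ih =>
    calc N (p + (n + 1)) = N (p + n) * (N (p + n + 1) / N (p + n)) :=
          (mul_div_cancel₀ _ (hN.pos _).ne').symm
      _ ≤ N p * (N (k + 1) / N k) ^ n * (N (k + 1) / N k) :=
          mul_le_mul (ih (by omega)) (hN.monotone_quotient (by omega)) (hN.quotient_pos _).le
            (mul_nonneg (hN.pos _).le (pow_nonneg (hN.quotient_pos _).le _))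
      _ = _ := by ring

lemma LCseq.pow_div_le {N : ℕ → ℝ} (hN : LCseq N) (k p : ℕ) :
    (N (k + 1) / N k) ^ p / N p ≤ (N (k + 1) / N k) ^ k / N k := by
  rw [div_le_div_iff₀ (hN.pos _) (hN.pos _)]
  have hm := hN.quotient_pos k
  rcases le_total k p with hkp | hpk
  · obtain ⟨n, rfl⟩ := Nat.exists_eq_add_of_le hkp
    calc _ = (N (k + 1) / N k) ^ k * (N k * (N (k + 1) / N k) ^ n) := by ring
      _ ≤ _ := by gcongr; exact hN.mul_pow_le k n
  · obtain ⟨n, rfl⟩ := Nat.exists_eq_add_of_le hpk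
    calc _ ≤ (N (p + n + 1) / N (p + n)) ^ p * (N p * (N (p + n + 1) / N (p + n)) ^ n) := by
          gcongr; exact hN.le_mul_pow p n (p + n) le_rfl
      _ = _ := by ring

lemma LCseq.bddAbove_log {N : ℕ → ℝ} (hN : LCseq N) {t : ℝ} (ht : 0 < t) :
    BddAbove (Set.range fun p : ℕ => Real.log (t ^ p / N p)) := by
  refine Filter.IsBoundedUnder.bddAbove_range ⟨0, ?_⟩
  rw [Filter.eventually_map]
  filter_upwards [hN.2.2.2.2.eventually_ge_atTop t, eventually_ge_atTop 1] with p hp hp1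
  refine Real.log_nonpos (div_pos (pow_pos ht p) (hN.pos p)).le ((div_le_one (hN.pos p)).2 ?_)
  calc t ^ p ≤ (N p ^ ((1 : ℝ) / p)) ^ p := by gcongr
    _ = N p := by
      rw [one_div]
      exact Real.rpow_inv_natCast_pow (hN.pos p).le (by omega)

lemma LCseq.log_le_assocWeight {N : ℕ → ℝ} (hN : LCseq N) {t : ℝ} (ht : 0 < t) (p : ℕ) :
    Real.log (t ^ p / N p) ≤ assocWeight N t := by
  rw [assocWeight, if_neg ht.not_ge]
  exact le_ciSup (hN.bddAbove_log ht) p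

lemma assocWeight_le {N : ℕ → ℝ} {t B : ℝ} (ht : 0 < t)
    (hB : ∀ p : ℕ, Real.log (t ^ p / N p) ≤ B) : assocWeight N t ≤ B := by
  rw [assocWeight, if_neg ht.not_ge]
  exact ciSup_le hB

lemma LCseq.assocWeight_mono {N : ℕ → ℝ} (hN : LCseq N) {t u : ℝ} (ht : 0 < t) (htu : t ≤ u) :
    assocWeight N t ≤ assocWeight N u := by
  refine assocWeight_le ht fun p => le_trans ?_ (hN.log_le_assocWeight (ht.trans_le htu) p)
  have := hN.pos p
  gcongr

lemma LCseq.assocWeight_nonneg {N : ℕ → ℝ} (hN : LCseq N) {t : ℝ} (ht : 0 < t) :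
    0 ≤ assocWeight N t := by
  simpa [hN.2.1] using hN.log_le_assocWeight ht 0

lemma LCseq.pow_quotient_le {N : ℕ → ℝ} (hN : LCseq N) {C : ℝ}
    (hmg : ∀ j k : ℕ, N (j + k) ≤ C ^ (j + k) * N j * N k) (k n : ℕ) :
    (N (k + 1) / N k) ^ n ≤ C ^ (k + n) * N n := by
  have h := (hN.mul_pow_le k n).trans (hmg k n)
  rw [mul_right_comm, mul_comm] at h
  exact le_of_mul_le_mul_right h (hN.pos k)

lemma LCseq.assocWeight_quotient_le {N : ℕ → ℝ} (hN : LCseq N) {C : ℝ}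
    (hmg : ∀ j k : ℕ, N (j + k) ≤ C ^ (j + k) * N j * N k) (k : ℕ) :
    assocWeight N (N (k + 1) / N k) ≤ k * (2 * Real.log C) := by
  have hm := hN.quotient_pos k
  refine assocWeight_le hm fun p => ?_
  calc _ ≤ Real.log (C ^ (k + k)) := by
        refine Real.log_le_log (div_pos (pow_pos hm p) (hN.pos p)) ((hN.pow_div_le k p).trans ?_)
        rw [div_le_iff₀ (hN.pos k)]
        exact hN.pow_quotient_le hmg k k
    _ = _ := by
        rw [Real.log_pow]
        push_cast
        ring

lemma LCseq.le_assocWeight_exp_mul_quotient {N : ℕ → ℝ} (hN : LCseq N) (k : ℕ) :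
    (k : ℝ) + 1 ≤ assocWeight N (Real.exp 1 * (N (k + 1) / N k)) := by
  have hm := hN.quotient_pos k
  refine le_trans ?_ (hN.log_le_assocWeight (mul_pos (Real.exp_pos 1) hm) (k + 1))
  rw [Real.le_log_iff_exp_le (div_pos (pow_pos (mul_pos (Real.exp_pos 1) hm) _) (hN.pos _)),
    le_div_iff₀ (hN.pos _), mul_pow, ← Real.exp_nat_mul, mul_one]
  push_cast
  have h1 : N k ≤ (N (k + 1) / N k) ^ k := by
    simpa [hN.2.1] using hN.le_mul_pow 0 k k (by omega)
  have h2 : N (k + 1) ≤ (N (k + 1) / N k) ^ (k + 1) := by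
    calc N (k + 1) = N k * (N (k + 1) / N k) := (mul_div_cancel₀ _ (hN.pos _).ne').symm
      _ ≤ _ := by rw [pow_succ]; gcongr
  gcongr

lemma LCseq.exists_assocWeight_mul_le {N : ℕ → ℝ} (hN : LCseq N) {a : ℝ} (ha : 0 < a)
    (hP : Pcond (assocWeight N) a) :
    ∃ K > 0, ∃ t₀ > 0, ∀ t ≥ t₀, ∀ l ≥ 1,
      assocWeight N (l * t) ≤ K * l ^ a⁻¹ * assocWeight N t := by
  obtain ⟨K, hK, c, hc, hev⟩ := hP
  have hK0 : 0 < K := by linarith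
  obtain ⟨t₁, ht₁⟩ := Filter.eventually_atTop.1 hev
  set t₂ := Real.exp 1 * (N (0 + 1) / N 0) with ht₂
  have ht₂0 : 0 < t₂ := mul_pos (Real.exp_pos 1) (hN.quotient_pos 0)
  have ht₂ω : 1 ≤ assocWeight N t₂ := by simpa using hN.le_assocWeight_exp_mul_quotient 0
  have hKa : 1 ≤ K ^ a := Real.one_le_rpow hK.le ha.le
  have hstep : ∀ t ≥ max t₁ t₂, assocWeight N (K ^ a * t) ≤ K * assocWeight N t := by
    intro t ht
    have hω : 0 < assocWeight N t := by
      linarith [hN.assocWeight_mono ht₂0 ((le_max_right _ _).trans ht)]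
    have := ht₁ t ((le_max_left _ _).trans ht)
    rw [div_le_iff₀ hω] at this
    exact this.trans (by gcongr)
  have hiter : ∀ n : ℕ, ∀ t ≥ max t₁ t₂,
      assocWeight N ((K ^ a) ^ n * t) ≤ K ^ n * assocWeight N t := by
    intro n
    induction n with
    | zero => intro t _; simp
    | succ n ih =>
      intro t ht
      have ht0 : 0 < t := ht₂0.trans_le ((le_max_right _ _).trans ht)
      have h1 : (K ^ a) ^ n * t ≥ max t₁ t₂ :=
        le_trans ht (le_mul_of_one_le_left ht0.le (one_le_pow₀ hKa))
      calc assocWeight N ((K ^ a) ^ (n + 1) * t) = assocWeight N (K ^ a * ((K ^ a) ^ n * t)) := by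
            congr 1; ring
        _ ≤ K * assocWeight N ((K ^ a) ^ n * t) := hstep _ h1
        _ ≤ K * (K ^ n * assocWeight N t) := by gcongr; exact ih t ht
        _ = _ := by ring
  refine ⟨K, hK0, max t₁ t₂, lt_max_of_lt_right ht₂0, fun t ht l hl => ?_⟩
  have ht0 : 0 < t := ht₂0.trans_le ((le_max_right _ _).trans ht)
  have hl0 : 0 < l := by linarith
  obtain ⟨n, hn1, hn2⟩ := exists_nat_pow_near
    (Real.one_le_rpow hl (inv_pos.2 ha).le : 1 ≤ l ^ a⁻¹) hK
  have hl' : l ≤ (K ^ a) ^ (n + 1) := by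
    calc l = (l ^ a⁻¹) ^ a := (Real.rpow_inv_rpow hl0.le ha.ne').symm
      _ ≤ (K ^ (n + 1)) ^ a := by gcongr
      _ = _ := by
        rw [← Real.rpow_natCast, ← Real.rpow_natCast, ← Real.rpow_mul hK0.le,
          ← Real.rpow_mul hK0.le, mul_comm]
  calc _ ≤ assocWeight N ((K ^ a) ^ (n + 1) * t) :=
        hN.assocWeight_mono (mul_pos hl0 ht0) (by gcongr)
    _ ≤ K ^ (n + 1) * assocWeight N t := hiter _ t ht
    _ ≤ _ := by
        have := hN.assocWeight_nonneg ht0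
        rw [pow_succ']
        gcongr

lemma LCseq.exists_quotient_regular {N : ℕ → ℝ} (hN : LCseq N) {C : ℝ} (hC : 1 ≤ C)
    (hmg : ∀ j k : ℕ, N (j + k) ≤ C ^ (j + k) * N j * N k) {a : ℝ} (ha : 0 < a)
    (hP : Pcond (assocWeight N) a) :
    ∃ D ≥ 1, ∀ p k : ℕ, p ≤ k →
      N (p + 1) / N p * (((k : ℝ) + 1) / (p + 1)) ^ a ≤ D * (N (k + 1) / N k) := by
  obtain ⟨K, hK0, t₀, ht₀, hω⟩ := hN.exists_assocWeight_mul_le ha hP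
  set B := 2 * Real.log C + assocWeight N t₀ with hB
  have hlogC : 0 ≤ Real.log C := Real.log_nonneg hC
  have hω0 := hN.assocWeight_nonneg ht₀
  have hB0 : 0 ≤ B := by positivity
  refine ⟨max 1 ((K * B) ^ a * Real.exp 1), le_max_left _ _, fun p k hpk => ?_⟩
  have hmp := hN.quotient_pos p
  have hmk := hN.quotient_pos k
  set mp := N (p + 1) / N p
  set mk := N (k + 1) / N k
  have hle : mp ≤ mk := hN.monotone_quotient hpk
  have hl : 1 ≤ Real.exp 1 * (mk / mp) :=
    one_le_mul_of_one_le_of_one_le (Real.one_le_exp zero_le_one) ((one_le_div hmp).2 hle)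
  have hl0 : 0 < Real.exp 1 * (mk / mp) := by positivity
  have hmax : assocWeight N (max mp t₀) ≤ B * (p + 1) := by
    have h1 : assocWeight N mp ≤ p * (2 * Real.log C) := hN.assocWeight_quotient_le hmg p
    have hp : (0 : ℝ) ≤ p := p.cast_nonneg
    have h2 : p * (2 * Real.log C) ≤ B * (p + 1) := by rw [hB]; nlinarith [mul_nonneg hp hω0]
    have h3 : assocWeight N t₀ ≤ B * (p + 1) := by
      rw [hB]; nlinarith [mul_nonneg hp hω0, mul_nonneg hp hlogC]
    rcases max_cases mp t₀ with ⟨h, _⟩ | ⟨h, _⟩ <;> rw [h] <;> linarith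
  have key : (k : ℝ) + 1 ≤ K * (Real.exp 1 * (mk / mp)) ^ a⁻¹ * (B * (p + 1)) := by
    calc (k : ℝ) + 1 ≤ assocWeight N (Real.exp 1 * mk) := hN.le_assocWeight_exp_mul_quotient k
      _ ≤ assocWeight N (Real.exp 1 * (mk / mp) * max mp t₀) := by
          refine hN.assocWeight_mono (by positivity) ?_
          calc Real.exp 1 * mk = Real.exp 1 * (mk / mp) * mp := by field_simp
            _ ≤ _ := by gcongr; exact le_max_left _ _
      _ ≤ K * (Real.exp 1 * (mk / mp)) ^ a⁻¹ * assocWeight N (max mp t₀) :=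
          hω _ (le_max_right _ _) _ hl
      _ ≤ _ := by gcongr
  have key2 : ((k : ℝ) + 1) / (p + 1) ≤ K * B * (Real.exp 1 * (mk / mp)) ^ a⁻¹ := by
    rw [div_le_iff₀ (by positivity)]
    linarith
  calc mp * (((k : ℝ) + 1) / (p + 1)) ^ a
      ≤ mp * (K * B * (Real.exp 1 * (mk / mp)) ^ a⁻¹) ^ a := by gcongr
    _ = (K * B) ^ a * Real.exp 1 * mk := by
        rw [Real.mul_rpow (by positivity) (by positivity), Real.rpow_inv_rpow hl0.le ha.ne']
        field_simp
    _ ≤ _ := by gcongr; exact le_max_right _ _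

namespace RoumieuExtension

/-! ### Sectors -/

lemma sector_subset_slitPlane {γ : ℝ} (hγ : γ ≤ 2) : sector γ ⊆ Complex.slitPlane := by
  rintro z ⟨hz, harg⟩
  rw [Complex.mem_slitPlane_iff_arg]
  refine ⟨fun h => ?_, hz⟩
  rw [h, abs_of_pos Real.pi_pos] at harg
  nlinarith [Real.pi_pos]

lemma sector_mono {γ δ : ℝ} (h : γ ≤ δ) : sector γ ⊆ sector δ := by
  rintro z ⟨hz, harg⟩
  refine ⟨hz, harg.trans_le ?_⟩
  have := Real.pi_pos
  gcongr

lemma isOpen_sector {γ : ℝ} (hγ : γ ≤ 2) : IsOpen (sector γ) := by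
  have h : sector γ =
      Complex.slitPlane ∩ (fun z => |Complex.arg z|) ⁻¹' Set.Iio (γ * Real.pi / 2) := by
    ext z
    constructor
    · intro hz
      exact ⟨sector_subset_slitPlane hγ hz, hz.2⟩
    · rintro ⟨h1, h2⟩
      exact ⟨Complex.slitPlane_ne_zero h1, h2⟩
  rw [h]
  refine ContinuousOn.isOpen_inter_preimage ?_ Complex.isOpen_slitPlane isOpen_Iio
  exact fun z hz => (Complex.continuousAt_arg hz).continuousWithinAt.abs

lemma ofReal_mem_sector {γ : ℝ} (hγ : 0 < γ) {t : ℝ} (ht : 0 < t) : (t : ℂ) ∈ sector γ := by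
  refine ⟨by exact_mod_cast ht.ne', ?_⟩
  rw [Complex.arg_ofReal_of_nonneg ht.le, abs_zero]
  have := Real.pi_pos
  positivity

lemma ofReal_div_mem_sector {γ : ℝ} (hγ : γ ≤ 2) {t : ℝ} (ht : 0 < t) {z : ℂ}
    (hz : z ∈ sector γ) : (t : ℂ) / z ∈ sector γ := by
  have hs := sector_subset_slitPlane hγ hz
  refine ⟨div_ne_zero (by exact_mod_cast ht.ne') hz.1, ?_⟩
  rw [div_eq_mul_inv, Complex.arg_real_mul _ ht, Complex.arg_inv,
    if_neg (Complex.mem_slitPlane_iff_arg.1 hs).1, abs_neg]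
  exact hz.2

lemma sector_eq_image_exp {γ : ℝ} (hγ : γ ≤ 2) :
    sector γ = Complex.exp '' {w : ℂ | |w.im| < γ * Real.pi / 2} := by
  ext z
  constructor
  · intro hz
    refine ⟨Complex.log z, ?_, Complex.exp_log hz.1⟩
    simpa [Complex.log_im] using hz.2
  · rintro ⟨w, hw, rfl⟩
    refine ⟨Complex.exp_ne_zero w, ?_⟩
    have hw' : |w.im| < γ * Real.pi / 2 := hw
    have h2 := abs_lt.1 hw'
    have hpi := Real.pi_pos
    have hle : γ * Real.pi / 2 ≤ Real.pi := by nlinarith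
    rwa [Complex.arg_exp, (toIocMod_eq_self Real.two_pi_pos).2]
    constructor <;> linarith [h2.1, h2.2]

lemma isPreconnected_sector {γ : ℝ} (hγ : γ ≤ 2) : IsPreconnected (sector γ) := by
  rw [sector_eq_image_exp hγ]
  refine IsPreconnected.image ?_ _ Complex.continuous_exp.continuousOn
  have : {w : ℂ | |w.im| < γ * Real.pi / 2} =
      Complex.imLm ⁻¹' Set.Ioo (-(γ * Real.pi / 2)) (γ * Real.pi / 2) := by
    ext w
    simp [abs_lt]
  rw [this]
  exact ((convex_Ioo _ _).is_linear_preimage Complex.imLm.isLinear).isPreconnected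

lemma exists_closedBall_subset_sector {γ δ : ℝ} (hγδ : γ < δ) (hδ : δ ≤ 2) :
    ∃ ε : ℝ, 0 < ε ∧ ε < 1 ∧ ∀ z ∈ sector γ, Metric.closedBall z (ε * ‖z‖) ⊆ sector δ := by
  have hpi := Real.pi_pos
  have hc : ContinuousAt (fun v : ℂ => |Complex.arg v|) 1 :=
    (Complex.continuousAt_arg Complex.one_mem_slitPlane).abs
  have hev : ∀ᶠ v : ℂ in nhds 1, |Complex.arg v| < (δ - γ) * Real.pi / 2 := by
    refine hc.eventually_lt continuousAt_const ?_
    simp only [Complex.arg_one, abs_zero]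
    have : 0 < δ - γ := by linarith
    positivity
  obtain ⟨η, hη, hball⟩ := Metric.eventually_nhds_iff.1 hev
  refine ⟨min (η / 2) (1 / 2), by positivity, by
    exact (min_le_right _ _).trans_lt (by norm_num), fun z hz w hw => ?_⟩
  set ε := min (η / 2) (1 / 2) with hε
  have hz0 : 0 < ‖z‖ := norm_pos_iff.2 hz.1
  have hε1 : ε ≤ η / 2 := min_le_left _ _
  have hε2 : ε ≤ 1 / 2 := min_le_right _ _
  have hv : dist (w / z) 1 ≤ ε := by
    rw [Metric.mem_closedBall, dist_eq_norm] at hw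
    rw [dist_eq_norm, div_sub_one hz.1, norm_div, div_le_iff₀ hz0]
    exact hw
  have hv0 : w / z ≠ 0 := by
    intro h0
    rw [h0] at hv
    simp at hv
    linarith
  have hva := hball (hv.trans_lt (by linarith : ε < η))
  have hw : w = z * (w / z) := by field_simp [hz.1]
  have hs := hz.2
  have hab := abs_add_le z.arg (w / z).arg
  have hlt : |z.arg + (w / z).arg| < δ * Real.pi / 2 := by linarith
  have h2 := abs_lt.1 hlt
  have hle : δ * Real.pi / 2 ≤ Real.pi := by nlinarith
  rw [hw]
  refine ⟨mul_ne_zero hz.1 hv0, ?_⟩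
  rwa [Complex.arg_mul hz.1 hv0]
  constructor <;> linarith [h2.1, h2.2]

/-! ### Holomorphic parameter integrals -/

lemma differentiableOn_integral_of_locally_dominated {α : Type*} [MeasurableSpace α]
    {μ : Measure α} {U : Set ℂ} (hU : IsOpen U) {F : ℂ → α → ℂ}
    (hmeas : ∀ z ∈ U, AEStronglyMeasurable (F z) μ)
    (hdiff : ∀ᵐ u ∂μ, DifferentiableOn ℂ (fun z => F z u) U)
    (hdom : ∀ z₀ ∈ U, ∃ r : ℝ, 0 < r ∧ ∃ B : α → ℝ, Integrable B μ ∧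
      ∀ᵐ u ∂μ, ∀ z ∈ Metric.ball z₀ r ∩ U, ‖F z u‖ ≤ B u) :
    DifferentiableOn ℂ (fun z => ∫ u, F z u ∂μ) U := by
  intro z₀ hz₀
  obtain ⟨r, hr, B, hB, hFB⟩ := hdom z₀ hz₀
  obtain ⟨ρ, hρ, hρU⟩ := Metric.isOpen_iff.1 hU z₀ hz₀
  set σ := min r ρ / 3 with hσ
  have hσ0 : 0 < σ := by positivity
  have hσr : 3 * σ ≤ r := by rw [hσ]; linarith [min_le_left r ρ]
  have hσρ : 3 * σ ≤ ρ := by rw [hσ]; linarith [min_le_right r ρ]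
  have hsub : ∀ z ∈ Metric.ball z₀ σ, Metric.closedBall z σ ⊆ Metric.ball z₀ r ∩ U := by
    intro z hz w hw
    rw [Metric.mem_ball] at hz
    rw [Metric.mem_closedBall] at hw
    have := dist_triangle w z z₀
    exact ⟨Metric.mem_ball.2 (by linarith), hρU (Metric.mem_ball.2 (by linarith))⟩
  have hself : ∀ z ∈ Metric.ball z₀ σ, z ∈ Metric.ball z₀ r ∩ U := fun z hz =>
    hsub z hz (Metric.mem_closedBall_self hσ0.le)
  have hderiv : ∀ᵐ u ∂μ, ∀ z ∈ Metric.ball z₀ σ,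
      HasDerivAt (fun z => F z u) (deriv (fun z => F z u) z) z := by
    filter_upwards [hdiff] with u hu z hz
    exact ((hu z (hself z hz).2).differentiableAt (hU.mem_nhds (hself z hz).2)).hasDerivAt
  have hbound : ∀ᵐ u ∂μ, ∀ z ∈ Metric.ball z₀ σ,
      ‖deriv (fun z => F z u) z‖ ≤ B u / σ := by
    filter_upwards [hdiff, hFB] with u hu hB z hz
    refine Complex.norm_deriv_le_of_forall_mem_sphere_norm_le hσ0 ?_ ?_
    · refine DifferentiableOn.diffContOnCl (hu.mono ?_)
      exact (Metric.closure_ball_subset_closedBall.trans (hsub z hz)).trans inter_subset_right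
    · exact fun w hw => hB w (hsub z hz (Metric.sphere_subset_closedBall hw))
  have hz₀σ : z₀ ∈ Metric.ball z₀ σ := Metric.mem_ball_self hσ0
  have hF'meas : AEStronglyMeasurable (fun u => deriv (fun z => F z u) z₀) μ := by
    let v : ℕ → ℂ := fun n => ((σ / 2 * (1 / ((n : ℝ) + 1)) : ℝ) : ℂ)
    have hvpos : ∀ n : ℕ, 0 < σ / 2 * (1 / ((n : ℝ) + 1)) := fun n =>
      mul_pos (half_pos hσ0) Nat.one_div_pos_of_nat
    have hvt : Filter.Tendsto v atTop (nhdsWithin 0 {0}ᶜ) := by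
      rw [tendsto_nhdsWithin_iff]
      constructor
      · have h1 : Filter.Tendsto (fun n : ℕ => σ / 2 * (1 / ((n : ℝ) + 1))) atTop (nhds 0) := by
          simpa using tendsto_one_div_add_atTop_nhds_zero_nat.const_mul (σ / 2)
        have h2 := (Complex.continuous_ofReal.tendsto 0).comp h1
        rwa [Complex.ofReal_zero] at h2
      · refine Filter.Eventually.of_forall fun n => ?_
        simp only [v, mem_compl_iff, mem_singleton_iff, Complex.ofReal_eq_zero]
        exact (hvpos n).ne'
    have hvU : ∀ n, z₀ + v n ∈ U := by
      intro n
      refine (hself _ ?_).2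
      rw [Metric.mem_ball, dist_eq_norm, add_sub_cancel_left, Complex.norm_real, Real.norm_eq_abs,
        abs_of_pos (hvpos n)]
      have : 1 / ((n : ℝ) + 1) ≤ 1 := by
        rw [div_le_one (by positivity)]
        linarith [n.cast_nonneg (α := ℝ)]
      nlinarith
    refine aestronglyMeasurable_of_tendsto_ae atTop
      (f := fun n u => (v n)⁻¹ • (F (z₀ + v n) u - F z₀ u)) (fun n => ?_) ?_
    · exact ((hmeas _ (hvU n)).sub (hmeas _ hz₀)).const_smul (v n)⁻¹
    · filter_upwards [hderiv] with u hu
      exact (hu z₀ hz₀σ).tendsto_slope_zero.comp hvt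
  have hInt : Integrable (F z₀) μ := by
    refine hB.mono' (hmeas _ hz₀) ?_
    filter_upwards [hFB] with u hu using hu z₀ (hself z₀ hz₀σ)
  have hmain := hasDerivAt_integral_of_dominated_loc_of_deriv_le (μ := μ) (F := F)
    (F' := fun z u => deriv (fun z => F z u) z) (bound := fun u => B u / σ)
    (Metric.ball_mem_nhds z₀ hσ0)
    (by filter_upwards [hU.mem_nhds hz₀] with z hz using hmeas z hz) hInt hF'meas hbound
    (hB.div_const σ) hderiv
  exact hmain.2.differentiableAt.differentiableWithinAt

/-! ### Kernels and truncated Laplace-type transforms -/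

/-- A bounded holomorphic kernel on the sector `S_δ` whose decay at infinity is governed
by the sequence `M`. -/
structure IsKernel (δ : ℝ) (M : ℕ → ℝ) (e : ℂ → ℂ) : Prop where
  differentiableOn : DifferentiableOn ℂ e (sector δ)
  norm_le_one : ∀ ζ ∈ sector δ, ‖e ζ‖ ≤ 1
  norm_mul_pow_le : ∀ ζ ∈ sector δ, ∀ n : ℕ, ‖e ζ‖ * ‖ζ‖ ^ n ≤ M n

/-- The moments of a kernel. -/
noncomputable def moment (e : ℂ → ℂ) (p : ℕ) : ℂ :=
  ∫ u in Set.Ioi (0 : ℝ), e u * (u : ℂ) ^ p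

/-- The transform `z ↦ z⁻¹ ∫_S e(u/z) u^p du` of the monomial `u^p` cut off to `S`. -/
noncomputable def transform (e : ℂ → ℂ) (S : Set ℝ) (p : ℕ) (z : ℂ) : ℂ :=
  z⁻¹ * ∫ u in S, e ((u : ℂ) / z) * (u : ℂ) ^ p

lemma integrable_inv_one_add_div_sq {c : ℝ} (hc : 0 < c) :
    Integrable (fun u : ℝ => (1 + (u / c) ^ 2)⁻¹) :=
  integrable_inv_one_add_sq.comp_div hc.ne'

lemma setIntegral_inv_one_add_div_sq_le {c : ℝ} (hc : 0 < c) :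
    ∫ u in Set.Ioi (0 : ℝ), (1 + (u / c) ^ 2)⁻¹ ≤ Real.pi * c := by
  have h1 : ∫ u in Set.Ioi (0 : ℝ), (1 + (u / c) ^ 2)⁻¹ ≤ ∫ u : ℝ, (1 + (u / c) ^ 2)⁻¹ :=
    setIntegral_le_integral (integrable_inv_one_add_div_sq hc)
      (Filter.Eventually.of_forall fun u => by positivity)
  have h2 := Measure.integral_comp_div (fun u : ℝ => (1 + u ^ 2)⁻¹) c
  rw [h2, integral_univ_inv_one_add_sq, abs_of_pos hc, smul_eq_mul] at h1
  linarith

namespace IsKernel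

variable {δ : ℝ} {M : ℕ → ℝ} {e : ℂ → ℂ}

lemma nonneg (he : IsKernel δ M e) (hδ0 : 0 < δ) (n : ℕ) : 0 ≤ M n :=
  (by positivity : (0 : ℝ) ≤ ‖e ((1 : ℝ) : ℂ)‖ * ‖((1 : ℝ) : ℂ)‖ ^ n).trans
    (he.norm_mul_pow_le _ (ofReal_mem_sector hδ0 one_pos) n)

lemma norm_le (he : IsKernel δ M e) (hδ0 : 0 < δ) (hδ : δ ≤ 2) {z : ℂ} (hz : z ∈ sector δ)
    {u : ℝ} (hu : 0 < u) (n : ℕ) :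
    ‖e ((u : ℂ) / z) * (u : ℂ) ^ n‖ ≤
      ‖z‖ ^ n * (2 * (1 + M (n + 2))) * (1 + (u / ‖z‖) ^ 2)⁻¹ := by
  have hζ := ofReal_div_mem_sector hδ hu hz
  have hz0 : 0 < ‖z‖ := norm_pos_iff.2 hz.1
  have h1 := he.norm_le_one _ hζ
  have h2 := he.norm_mul_pow_le _ hζ (n + 2)
  have hM := he.nonneg hδ0 (n + 2)
  have hnorm : ‖(u : ℂ) / z‖ = u / ‖z‖ := by
    rw [norm_div, Complex.norm_real, Real.norm_eq_abs, abs_of_pos hu]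
  rw [hnorm] at h2
  set t := u / ‖z‖ with ht
  have ht0 : 0 < t := by positivity
  set E := ‖e ((u : ℂ) / z)‖ with hE
  have hE0 : 0 ≤ E := norm_nonneg _
  have hut : u = ‖z‖ * t := by rw [ht]; field_simp
  have key : E * t ^ n ≤ 2 * (1 + M (n + 2)) * (1 + t ^ 2)⁻¹ := by
    rw [← div_eq_mul_inv, le_div_iff₀ (by positivity)]
    rcases le_total t 1 with h | h
    · have ha : t ^ n ≤ 1 := pow_le_one₀ ht0.le h
      have hb : t ^ 2 ≤ 1 := pow_le_one₀ ht0.le h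
      have hc : E * t ^ n ≤ 1 := mul_le_one₀ h1 (by positivity) ha
      nlinarith [mul_nonneg hE0 (pow_nonneg ht0.le n)]
    · have hb : 1 ≤ t ^ 2 := one_le_pow₀ h
      have : E * t ^ n * (1 + t ^ 2) ≤ E * t ^ n * (2 * t ^ 2) := by
        gcongr
        linarith
      calc _ ≤ _ := this
        _ = 2 * (E * t ^ (n + 2)) := by ring
        _ ≤ _ := by linarith
  rw [norm_mul, norm_pow, Complex.norm_real, Real.norm_eq_abs, abs_of_pos hu]
  calc E * u ^ n = ‖z‖ ^ n * (E * t ^ n) := by rw [hut]; ring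
    _ ≤ ‖z‖ ^ n * (2 * (1 + M (n + 2)) * (1 + t ^ 2)⁻¹) := by gcongr
    _ = _ := by ring

lemma aestronglyMeasurable (he : IsKernel δ M e) (hδ : δ ≤ 2) {z : ℂ}
    (hz : z ∈ sector δ) {S : Set ℝ} (hS : S ⊆ Set.Ioi 0) (p : ℕ) :
    AEStronglyMeasurable (fun u : ℝ => e ((u : ℂ) / z) * (u : ℂ) ^ p) (volume.restrict S) := by
  have hc : ContinuousOn (fun u : ℝ => e ((u : ℂ) / z) * (u : ℂ) ^ p) (Set.Ioi 0) := by
    refine ContinuousOn.mul ?_ (by fun_prop)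
    refine he.differentiableOn.continuousOn.comp (by fun_prop) ?_
    exact fun u hu => ofReal_div_mem_sector hδ hu hz
  exact (hc.aestronglyMeasurable measurableSet_Ioi).mono_measure (Measure.restrict_mono hS le_rfl)

lemma integrableOn (he : IsKernel δ M e) (hδ0 : 0 < δ) (hδ : δ ≤ 2) {z : ℂ}
    (hz : z ∈ sector δ) (p : ℕ) :
    IntegrableOn (fun u : ℝ => e ((u : ℂ) / z) * (u : ℂ) ^ p) (Set.Ioi 0) := by
  refine Integrable.mono' (((integrable_inv_one_add_div_sq (norm_pos_iff.2 hz.1)).const_mul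
    (‖z‖ ^ p * (2 * (1 + M (p + 2))))).integrableOn) (he.aestronglyMeasurable hδ hz subset_rfl p) ?_
  filter_upwards [ae_restrict_mem measurableSet_Ioi] with u hu
  exact he.norm_le hδ0 hδ hz hu p

lemma integral_norm_le (he : IsKernel δ M e) (hδ0 : 0 < δ) (hδ : δ ≤ 2) {z : ℂ}
    (hz : z ∈ sector δ) (p : ℕ) :
    ∫ u in Set.Ioi (0 : ℝ), ‖e ((u : ℂ) / z) * (u : ℂ) ^ p‖ ≤
      ‖z‖ * (‖z‖ ^ p * (2 * Real.pi * (1 + M (p + 2)))) := by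
  have hz0 : 0 < ‖z‖ := norm_pos_iff.2 hz.1
  have hM := he.nonneg hδ0 (p + 2)
  have h1 : ∫ u in Set.Ioi (0 : ℝ), ‖e ((u : ℂ) / z) * (u : ℂ) ^ p‖ ≤
      ∫ u in Set.Ioi (0 : ℝ), ‖z‖ ^ p * (2 * (1 + M (p + 2))) * (1 + (u / ‖z‖) ^ 2)⁻¹ := by
    refine setIntegral_mono_on (he.integrableOn hδ0 hδ hz p).norm
      ((integrable_inv_one_add_div_sq hz0).const_mul _).integrableOn measurableSet_Ioi ?_
    exact fun u hu => he.norm_le hδ0 hδ hz hu p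
  rw [integral_const_mul] at h1
  refine h1.trans ?_
  calc _ ≤ ‖z‖ ^ p * (2 * (1 + M (p + 2))) * (Real.pi * ‖z‖) := by
        gcongr
        exact setIntegral_inv_one_add_div_sq_le hz0
    _ = _ := by ring

lemma differentiableOn_transform (he : IsKernel δ M e) (hδ0 : 0 < δ) (hδ : δ ≤ 2) {S : Set ℝ}
    (hSm : MeasurableSet S) (hS : S ⊆ Set.Ioi 0) (p : ℕ) :
    DifferentiableOn ℂ (transform e S p) (sector δ) := by
  have hinv : DifferentiableOn ℂ (fun z : ℂ => z⁻¹) (sector δ) := fun z hz =>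
    (differentiableAt_inv hz.1).differentiableWithinAt
  refine hinv.mul (differentiableOn_integral_of_locally_dominated (isOpen_sector hδ)
    (fun z hz => he.aestronglyMeasurable hδ hz hS p) ?_ ?_)
  · filter_upwards [ae_restrict_mem hSm] with u hu
    refine DifferentiableOn.mul_const (he.differentiableOn.comp (hinv.const_mul _) ?_) _
    intro z hz
    simpa only [div_eq_mul_inv] using ofReal_div_mem_sector hδ (hS hu) hz
  · intro z₀ hz₀
    have hz0 : 0 < ‖z₀‖ := norm_pos_iff.2 hz₀.1
    have hM := he.nonneg hδ0 (p + 2)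
    refine ⟨‖z₀‖, hz0, fun u => (2 * ‖z₀‖) ^ p * (2 * (1 + M (p + 2))) *
      (1 + (u / (2 * ‖z₀‖)) ^ 2)⁻¹,
      ((integrable_inv_one_add_div_sq (by positivity)).const_mul _).integrableOn, ?_⟩
    filter_upwards [ae_restrict_mem hSm] with u hu z hz
    have hu0 : 0 < u := hS hu
    have hzn : 0 < ‖z‖ := norm_pos_iff.2 hz.2.1
    have hz2 : ‖z‖ ≤ 2 * ‖z₀‖ := by
      have h1 := mem_ball_iff_norm.1 hz.1
      have h2 := norm_le_norm_add_norm_sub' z z₀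
      linarith
    refine (he.norm_le hδ0 hδ hz.2 hu0 p).trans ?_
    gcongr

lemma transform_Ioi_zero (he : IsKernel δ M e) (hδ0 : 0 < δ) (hδ : δ ≤ 2) (p : ℕ) {z : ℂ}
    (hz : z ∈ sector δ) : transform e (Set.Ioi 0) p z = z ^ p * moment e p := by
  have hreal : ∀ x : ℝ, 0 < x →
      transform e (Set.Ioi 0) p (x : ℂ) = (x : ℂ) ^ p * moment e p := by
    intro x hx
    have hx' : (x : ℂ) ≠ 0 := by exact_mod_cast hx.ne'
    have h := integral_comp_mul_left_Ioi
      (fun t : ℝ => e (t : ℂ) * ((x : ℂ) * (t : ℂ)) ^ p) 0 (inv_pos.2 hx)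
    rw [inv_inv, mul_zero] at h
    have h1 : ∫ u in Set.Ioi (0 : ℝ), e ((u : ℂ) / x) * (u : ℂ) ^ p =
        ∫ u in Set.Ioi (0 : ℝ), e ((x⁻¹ * u : ℝ) : ℂ) *
          ((x : ℂ) * ((x⁻¹ * u : ℝ) : ℂ)) ^ p := by
      congr 1 with u
      push_cast
      rw [mul_inv_cancel_left₀ hx', div_eq_inv_mul]
    rw [transform, h1, h, moment]
    simp_rw [mul_pow, mul_left_comm _ ((x : ℂ) ^ p)]
    rw [integral_const_mul, Complex.real_smul, inv_mul_cancel_left₀ hx']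
  have h1 := (he.differentiableOn_transform hδ0 hδ measurableSet_Ioi subset_rfl p).analyticOnNhd
    (isOpen_sector hδ)
  have h2 : AnalyticOnNhd ℂ (fun z : ℂ => z ^ p * moment e p) (sector δ) :=
    (((differentiable_id.pow p).mul_const _).differentiableOn).analyticOnNhd (isOpen_sector hδ)
  refine h1.eqOn_of_preconnected_of_frequently_eq h2 (isPreconnected_sector hδ)
    (z₀ := ((1 : ℝ) : ℂ)) (ofReal_mem_sector hδ0 one_pos) ?_ hz
  have ht : Filter.Tendsto (fun x : ℝ => (x : ℂ)) (nhdsWithin 1 {1}ᶜ)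
      (nhdsWithin ((1 : ℝ) : ℂ) {((1 : ℝ) : ℂ)}ᶜ) := by
    refine tendsto_nhdsWithin_iff.2 ⟨(Complex.continuous_ofReal.tendsto 1).mono_left
      nhdsWithin_le_nhds, ?_⟩
    filter_upwards [self_mem_nhdsWithin] with x hx
    simpa using hx
  refine ht.frequently (Filter.Eventually.frequently ?_)
  filter_upwards [nhdsWithin_le_nhds (lt_mem_nhds (zero_lt_one (α := ℝ)))] with x hx
  exact hreal x hx

lemma norm_transform_le (he : IsKernel δ M e) (hδ0 : 0 < δ) (hδ : δ ≤ 2) {S : Set ℝ}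
    (hSm : MeasurableSet S) (hS : S ⊆ Set.Ioi 0) {p N : ℕ} {c : ℝ} (hc : 0 ≤ c)
    (hpN : ∀ u ∈ S, u ^ p ≤ c * u ^ N) {z : ℂ} (hz : z ∈ sector δ) :
    ‖transform e S p z‖ ≤ c * (‖z‖ ^ N * (2 * Real.pi * (1 + M (N + 2)))) := by
  have hz0 : 0 < ‖z‖ := norm_pos_iff.2 hz.1
  have hN : IntegrableOn (fun u : ℝ => ‖e ((u : ℂ) / z) * (u : ℂ) ^ N‖) (Set.Ioi 0) :=
    (he.integrableOn hδ0 hδ hz N).norm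
  have h1 : ‖∫ u in S, e ((u : ℂ) / z) * (u : ℂ) ^ p‖ ≤
      ∫ u in S, c * ‖e ((u : ℂ) / z) * (u : ℂ) ^ N‖ := by
    refine (norm_integral_le_integral_norm _).trans ?_
    refine setIntegral_mono_on ((he.integrableOn hδ0 hδ hz p).mono_set hS).norm
      ((hN.mono_set hS).const_mul c) hSm fun u hu => ?_
    have hu0 : 0 < u := hS hu
    rw [norm_mul, norm_mul, norm_pow, norm_pow, Complex.norm_real, Real.norm_eq_abs,
      abs_of_pos hu0]
    calc _ ≤ ‖e ((u : ℂ) / z)‖ * (c * u ^ N) := by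
          gcongr
          exact hpN u hu
      _ = _ := by ring
  rw [integral_const_mul] at h1
  have h2 : ∫ u in S, ‖e ((u : ℂ) / z) * (u : ℂ) ^ N‖ ≤
      ∫ u in Set.Ioi (0 : ℝ), ‖e ((u : ℂ) / z) * (u : ℂ) ^ N‖ :=
    setIntegral_mono_set hN (Filter.Eventually.of_forall fun u => norm_nonneg _)
      (Filter.Eventually.of_forall hS)
  rw [transform, norm_mul, norm_inv, inv_mul_le_iff₀ hz0]
  calc _ ≤ _ := h1
    _ ≤ c * (‖z‖ * (‖z‖ ^ N * (2 * Real.pi * (1 + M (N + 2))))) := by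
        gcongr
        exact h2.trans (he.integral_norm_le hδ0 hδ hz N)
    _ = _ := by ring

/-- Removing from the truncated transform of `u ^ p` the value `z ^ p * moment e p` of the full
transform, when `p < N`, leaves a quantity of order `‖z‖ ^ N` with geometric control in `p`. -/
lemma norm_transform_sub_le (he : IsKernel δ M e) (hδ0 : 0 < δ) (hδ : δ ≤ 2) {R : ℝ} (hR : 0 < R)
    (p N : ℕ) {z : ℂ} (hz : z ∈ sector δ) :
    ‖transform e (Set.Ioc 0 R) p z - if p < N then z ^ p * moment e p else 0‖ ≤
      R ^ p * (‖z‖ ^ N * (2 * Real.pi * (1 + M (N + 2))) / R ^ N) := by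
  have hrw : R ^ p * (‖z‖ ^ N * (2 * Real.pi * (1 + M (N + 2))) / R ^ N) =
      R ^ p / R ^ N * (‖z‖ ^ N * (2 * Real.pi * (1 + M (N + 2)))) := by ring
  rw [hrw]
  split_ifs with hpN
  · have hsplit : transform e (Set.Ioc 0 R) p z + transform e (Set.Ioi R) p z =
        transform e (Set.Ioi 0) p z := by
      have hInt := he.integrableOn hδ0 hδ hz p
      rw [transform, transform, transform, ← mul_add, ← setIntegral_union
        (Set.Ioc_disjoint_Ioi le_rfl) measurableSet_Ioi (hInt.mono_set Set.Ioc_subset_Ioi_self)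
        (hInt.mono_set (Set.Ioi_subset_Ioi hR.le)), Set.Ioc_union_Ioi_eq_Ioi hR.le]
    rw [← he.transform_Ioi_zero hδ0 hδ p hz, ← hsplit, sub_add_cancel_left, norm_neg]
    refine he.norm_transform_le hδ0 hδ measurableSet_Ioi (Set.Ioi_subset_Ioi hR.le)
      (by positivity) (fun u hu => ?_) hz
    have hu' : R ≤ u := le_of_lt hu
    have hu0 : 0 < u := hR.trans_le hu'
    obtain ⟨k, rfl⟩ := Nat.exists_eq_add_of_le hpN.le
    rw [pow_add, pow_add, div_mul_eq_mul_div, le_div_iff₀ (by positivity)]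
    have : R ^ k ≤ u ^ k := by gcongr
    calc _ = u ^ p * R ^ p * R ^ k := by ring
      _ ≤ u ^ p * R ^ p * u ^ k := by gcongr
      _ = _ := by ring
  · rw [sub_zero]
    refine he.norm_transform_le hδ0 hδ measurableSet_Ioc Set.Ioc_subset_Ioi_self
      (by positivity) (fun u hu => ?_) hz
    obtain ⟨k, rfl⟩ := Nat.exists_eq_add_of_le (not_lt.1 hpN)
    have hu0 : 0 < u := hu.1
    have hu' : u ^ k ≤ R ^ k := pow_le_pow_left₀ hu0.le hu.2 k
    rw [pow_add, pow_add, mul_div_cancel_left₀ _ (by positivity)]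
    nlinarith [pow_pos hu0 N]

end IsKernel

/-! ### The extension operator attached to a kernel -/

lemma iteratedDeriv_sum_range_mul_pow (p N : ℕ) (b : ℕ → ℂ) (z : ℂ) :
    iteratedDeriv p (fun w : ℂ => ∑ k ∈ Finset.range N, b k * w ^ k) z =
      ∑ k ∈ Finset.range N, b k * ((k.descFactorial p : ℂ) * z ^ (k - p)) := by
  rw [iteratedDeriv_fun_sum fun k _ => by fun_prop]
  refine Finset.sum_congr rfl fun k _ => ?_
  rw [iteratedDeriv_const_mul_field, iteratedDeriv_pow]

lemma iteratedDeriv_sum_range_self (p : ℕ) (b : ℕ → ℂ) (z : ℂ) :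
    iteratedDeriv p (fun w : ℂ => ∑ k ∈ Finset.range p, b k * w ^ k) z = 0 := by
  rw [iteratedDeriv_sum_range_mul_pow]
  refine Finset.sum_eq_zero fun k hk => ?_
  rw [Nat.descFactorial_of_lt (Finset.mem_range.1 hk)]
  simp

lemma iteratedDeriv_sum_range_succ (p : ℕ) (b : ℕ → ℂ) (z : ℂ) :
    iteratedDeriv p (fun w : ℂ => ∑ k ∈ Finset.range (p + 1), b k * w ^ k) z =
      b p * (p.factorial : ℂ) := by
  rw [iteratedDeriv_sum_range_mul_pow, Finset.sum_range_succ,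
    ← iteratedDeriv_sum_range_mul_pow, iteratedDeriv_sum_range_self]
  simp [Nat.descFactorial_self]

/-- Cauchy estimates for the remainder of an asymptotic expansion in a larger sector. -/
lemma norm_iteratedDeriv_sub_le {U : Set ℂ} (hU : IsOpen U) {f : ℂ → ℂ}
    (hf : DifferentiableOn ℂ f U) {b : ℕ → ℂ} {N : ℕ} {Q ε : ℝ} (hQ : 0 ≤ Q)
    (hrem : ∀ z ∈ U, ‖f z - ∑ k ∈ Finset.range N, b k * z ^ k‖ ≤ Q * ‖z‖ ^ N)
    (hε : 0 < ε) (hε1 : ε < 1) {z : ℂ} (hz0 : z ≠ 0)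
    (hz : Metric.closedBall z (ε * ‖z‖) ⊆ U) (p : ℕ) :
    ‖iteratedDeriv p f z -
        iteratedDeriv p (fun w : ℂ => ∑ k ∈ Finset.range N, b k * w ^ k) z‖ ≤
      p.factorial * (Q * (2 * ‖z‖) ^ N) / (ε * ‖z‖) ^ p := by
  have hzn : 0 < ‖z‖ := norm_pos_iff.2 hz0
  have hεz : 0 < ε * ‖z‖ := by positivity
  have hzU : z ∈ U := hz (Metric.mem_closedBall_self hεz.le)
  have hpoly : Differentiable ℂ (fun w : ℂ => ∑ k ∈ Finset.range N, b k * w ^ k) := by fun_prop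
  have hfz : ContDiffAt ℂ p f z := (hf.analyticAt (hU.mem_nhds hzU)).contDiffAt
  rw [← iteratedDeriv_sub hfz hpoly.contDiff.contDiffAt]
  refine Complex.norm_iteratedDeriv_le_of_forall_mem_sphere_norm_le p hεz ?_ ?_
  · exact ((hf.sub hpoly.differentiableOn).mono
      (Metric.closure_ball_subset_closedBall.trans hz)).diffContOnCl
  · intro w hw
    refine (hrem w (hz (Metric.sphere_subset_closedBall hw))).trans ?_
    have h1 : ‖w - z‖ = ε * ‖z‖ := mem_sphere_iff_norm.1 hw
    have h2 := norm_le_norm_add_norm_sub' w z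
    have h3 : ‖w‖ ≤ 2 * ‖z‖ := by nlinarith
    gcongr

namespace IsKernel

variable {δ : ℝ} {M : ℕ → ℝ} {e : ℂ → ℂ}

lemma norm_transform_Ioc_le (he : IsKernel δ M e) (hδ0 : 0 < δ) (hδ : δ ≤ 2) {R : ℝ} (hR : 0 < R)
    (p : ℕ) {z : ℂ} (hz : z ∈ sector δ) :
    ‖transform e (Set.Ioc 0 R) p z‖ ≤ R ^ p * (2 * Real.pi * (1 + M 2)) := by
  simpa using he.norm_transform_sub_le hδ0 hδ hR p 0 hz

lemma norm_mul_transform_le (he : IsKernel δ M e) (hδ0 : 0 < δ) (hδ : δ ≤ 2) {R : ℝ} (hR : 0 < R)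
    {a : ℕ → ℂ} {B : ℝ} (ha : ∀ p, ‖a p‖ * R ^ p ≤ B * (1 / 2) ^ p)
    (p : ℕ) {z : ℂ} (hz : z ∈ sector δ) :
    ‖a p * transform e (Set.Ioc 0 R) p z‖ ≤ B * (1 / 2) ^ p * (2 * Real.pi * (1 + M 2)) := by
  have hM := he.nonneg hδ0 2
  rw [norm_mul]
  calc _ ≤ ‖a p‖ * (R ^ p * (2 * Real.pi * (1 + M 2))) := by
        gcongr
        exact he.norm_transform_Ioc_le hδ0 hδ hR p hz
    _ = ‖a p‖ * R ^ p * (2 * Real.pi * (1 + M 2)) := by ring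
    _ ≤ _ := by
        exact mul_le_mul_of_nonneg_right (ha p) (by positivity)

lemma summable_mul_transform (he : IsKernel δ M e) (hδ0 : 0 < δ) (hδ : δ ≤ 2) {R : ℝ} (hR : 0 < R)
    {a : ℕ → ℂ} {B : ℝ} (ha : ∀ p, ‖a p‖ * R ^ p ≤ B * (1 / 2) ^ p)
    {z : ℂ} (hz : z ∈ sector δ) :
    Summable fun p => a p * transform e (Set.Ioc 0 R) p z :=
  Summable.of_norm_bounded ((summable_geometric_two.mul_left B).mul_right _)
    fun p => he.norm_mul_transform_le hδ0 hδ hR ha p hz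

lemma differentiableOn_tsum (he : IsKernel δ M e) (hδ0 : 0 < δ) (hδ : δ ≤ 2) {R : ℝ} (hR : 0 < R)
    {a : ℕ → ℂ} {B : ℝ} (ha : ∀ p, ‖a p‖ * R ^ p ≤ B * (1 / 2) ^ p) :
    DifferentiableOn ℂ (fun z => ∑' p, a p * transform e (Set.Ioc 0 R) p z) (sector δ) :=
  Complex.differentiableOn_tsum_of_summable_norm
    ((summable_geometric_two.mul_left B).mul_right (2 * Real.pi * (1 + M 2)))
    (fun p => (he.differentiableOn_transform hδ0 hδ measurableSet_Ioc
      Set.Ioc_subset_Ioi_self p).const_mul (a p)) (isOpen_sector hδ)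
    (fun p _ hz => he.norm_mul_transform_le hδ0 hδ hR ha p hz)

lemma norm_tsum_sub_le (he : IsKernel δ M e) (hδ0 : 0 < δ) (hδ : δ ≤ 2) {R : ℝ} (hR : 0 < R)
    {a : ℕ → ℂ} {B : ℝ} (ha : ∀ p, ‖a p‖ * R ^ p ≤ B * (1 / 2) ^ p) (N : ℕ)
    {z : ℂ} (hz : z ∈ sector δ) :
    ‖(∑' p, a p * transform e (Set.Ioc 0 R) p z) -
        ∑ p ∈ Finset.range N, a p * moment e p * z ^ p‖ ≤
      2 * B * (2 * Real.pi * (1 + M (N + 2))) / R ^ N * ‖z‖ ^ N := by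
  have hM := he.nonneg hδ0 (N + 2)
  set T : ℕ → ℂ := fun p => if p < N then z ^ p * moment e p else 0 with hT
  have hTz : ∀ p ∉ Finset.range N, a p * T p = 0 := by
    intro p hp
    rw [hT]
    simp only [if_neg (Finset.mem_range.not.1 hp), mul_zero]
  have hsum : ∑ p ∈ Finset.range N, a p * moment e p * z ^ p = ∑' p, a p * T p := by
    rw [tsum_eq_sum hTz]
    refine Finset.sum_congr rfl fun p hp => ?_
    rw [hT]
    simp only [if_pos (Finset.mem_range.1 hp)]
    ring
  rw [hsum, ← (he.summable_mul_transform hδ0 hδ hR ha hz).tsum_sub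
    (summable_of_ne_finset_zero hTz)]
  have hle : ∀ p, ‖a p * transform e (Set.Ioc 0 R) p z - a p * T p‖ ≤
      B * (1 / 2) ^ p * (‖z‖ ^ N * (2 * Real.pi * (1 + M (N + 2))) / R ^ N) := by
    intro p
    rw [← mul_sub, norm_mul]
    calc _ ≤ ‖a p‖ * (R ^ p * (‖z‖ ^ N * (2 * Real.pi * (1 + M (N + 2))) / R ^ N)) := by
          gcongr
          exact he.norm_transform_sub_le hδ0 hδ hR p N hz
      _ = ‖a p‖ * R ^ p * (‖z‖ ^ N * (2 * Real.pi * (1 + M (N + 2))) / R ^ N) := by ring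
      _ ≤ _ := by
          exact mul_le_mul_of_nonneg_right (ha p) (by positivity)
  have hhas := (hasSum_geometric_two.mul_left B).mul_right
    (‖z‖ ^ N * (2 * Real.pi * (1 + M (N + 2))) / R ^ N)
  refine (tsum_of_norm_bounded hhas hle).trans_eq ?_
  ring

/-- A kernel whose moments are comparable from below with `M` yields an extension operator. -/
theorem exists_extension (he : IsKernel δ M e) {γ : ℝ} (hγ0 : 0 < γ) (hγδ : γ < δ) (hδ : δ ≤ 2)
    (hMpos : ∀ p, 0 < M p) {c D : ℝ} (hc : 0 < c) (hD : 0 < D)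
    (hmom : ∀ p, c ^ (p + 1) * M p ≤ ‖moment e p‖)
    (hgrowth : ∀ p, 1 + M (p + 2) ≤ D ^ (p + 1) * M p)
    {Mhat : ℕ → ℝ} (hMhat : ∀ p, Mhat p = (p.factorial : ℝ) * M p) {h : ℝ} (hh : 0 < h) :
    ∃ h₁ : ℝ, 0 < h₁ ∧
      ∃ E : (ℕ → ℂ) →ₗ[ℂ] (ℂ → ℂ), ∃ C : ℝ, 0 ≤ C ∧
        ∀ lam : ℕ → ℂ, ∀ A : ℝ,
          (∀ p : ℕ, ‖lam p‖ ≤ A * h ^ p * Mhat p) →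
          DifferentiableOn ℂ (E lam) (sector γ) ∧
          (∀ z ∈ sector γ, ∀ p : ℕ,
            ‖iteratedDeriv p (E lam) z‖ ≤ C * A * h₁ ^ p * Mhat p) ∧
          (∀ p : ℕ, Filter.Tendsto (iteratedDeriv p (E lam))
            (nhdsWithin 0 (sector γ)) (nhds (lam p))) := by
  have hδ0 : 0 < δ := hγ0.trans hγδ
  obtain ⟨ε, hε, hε1, hball⟩ := exists_closedBall_subset_sector hγδ hδ
  set R : ℝ := c / (2 * h) with hRdef
  have hR : 0 < R := by positivity
  have hmom0 : ∀ p, 0 < ‖moment e p‖ := fun p =>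
    (mul_pos (pow_pos hc _) (hMpos p)).trans_le (hmom p)
  let coef : (ℕ → ℂ) → ℕ → ℂ := fun lam p => lam p / ((p.factorial : ℂ) * moment e p)
  have hcoef : ∀ lam : ℕ → ℂ, ∀ A : ℝ, (∀ p : ℕ, ‖lam p‖ ≤ A * h ^ p * Mhat p) →
      ∀ p, ‖coef lam p‖ * R ^ p ≤ A / c * (1 / 2) ^ p := by
    intro lam A hlam p
    have hA : 0 ≤ A := by
      have := (norm_nonneg _).trans (hlam 0)
      rw [pow_zero, mul_one, hMhat] at this
      exact nonneg_of_mul_nonneg_left this (mul_pos (by positivity) (hMpos 0))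
    have hp := hlam p
    have hfac : (0 : ℝ) < p.factorial := by positivity
    have hden : 0 < (p.factorial : ℝ) * ‖moment e p‖ := mul_pos hfac (hmom0 p)
    have h1 : ‖coef lam p‖ ≤ A / c * (h / c) ^ p := by
      simp only [coef]
      rw [norm_div, norm_mul, Complex.norm_natCast, div_le_iff₀ hden]
      refine hp.trans ?_
      calc A * h ^ p * Mhat p
          = A / c * (h / c) ^ p * (p.factorial * (c ^ (p + 1) * M p)) := by
            rw [hMhat, div_pow, pow_succ c p]
            field_simp
        _ ≤ _ := by
            gcongr
            exact hmom p
    calc _ ≤ A / c * (h / c) ^ p * R ^ p := by gcongr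
      _ = _ := by
        rw [mul_assoc, ← mul_pow, hRdef]
        congr 2
        field_simp
  let V : Submodule ℂ (ℕ → ℂ) :=
    { carrier := {lam | ∃ A : ℝ, ∀ p : ℕ, ‖lam p‖ ≤ A * h ^ p * Mhat p}
      add_mem' := by
        rintro a b ⟨A, hA⟩ ⟨B, hB⟩
        refine ⟨A + B, fun p => (norm_add_le _ _).trans ?_⟩
        linarith [hA p, hB p]
      zero_mem' := ⟨0, fun p => by simp⟩
      smul_mem' := by
        rintro k a ⟨A, hA⟩
        refine ⟨‖k‖ * A, fun p => ?_⟩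
        rw [Pi.smul_apply, norm_smul]
        calc _ ≤ ‖k‖ * (A * h ^ p * Mhat p) := by
              gcongr
              exact hA p
          _ = _ := by ring }
  have hsummable : ∀ lam ∈ V, ∀ z ∈ sector δ,
      Summable fun p => coef lam p * transform e (Set.Ioc 0 R) p z := by
    rintro lam ⟨A, hA⟩ z hz
    exact he.summable_mul_transform hδ0 hδ hR (hcoef lam A hA) hz
  let L : V →ₗ[ℂ] (ℂ → ℂ) :=
    { toFun := fun lam => (sector δ).indicator
        fun z => ∑' p, coef lam p * transform e (Set.Ioc 0 R) p z
      map_add' := by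
        intro x y
        rw [← Set.indicator_add']
        refine Set.indicator_congr fun z hz => ?_
        rw [Pi.add_apply, ← (hsummable x x.2 z hz).tsum_add (hsummable y y.2 z hz)]
        congr 1 with p
        simp only [coef, Submodule.coe_add, Pi.add_apply]
        ring
      map_smul' := by
        intro k x
        funext z
        by_cases hz : z ∈ sector δ
        swap
        · simp [hz]
        rw [RingHom.id_apply, Pi.smul_apply, Set.indicator_of_mem hz, Set.indicator_of_mem hz,
          smul_eq_mul, ← tsum_mul_left]
        congr 1 with p
        simp only [coef, Submodule.coe_smul, Pi.smul_apply, smul_eq_mul]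
        ring }
  obtain ⟨E, hE⟩ := L.exists_extend
  refine ⟨2 * D / (R * ε), by positivity, E, 4 * (2 * Real.pi) * D / (2 * c), by positivity,
    fun lam A hlam => ?_⟩
  have hEeq : Set.EqOn (E lam) (fun z => ∑' p, coef lam p * transform e (Set.Ioc 0 R) p z)
      (sector δ) := by
    intro z hz
    have : E lam = L ⟨lam, A, hlam⟩ := by rw [← hE]; rfl
    rw [this]
    exact Set.indicator_of_mem (M := ℂ) (s := sector δ) hz
      (fun z => ∑' p, coef lam p * transform e (Set.Ioc 0 R) p z)
  have hco := hcoef lam A hlam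
  have hA : 0 ≤ A / c := by
    have := (mul_nonneg (norm_nonneg _) (pow_nonneg hR.le _)).trans (hco 0)
    simpa using this
  have hdiff : DifferentiableOn ℂ (E lam) (sector δ) :=
    (he.differentiableOn_tsum hδ0 hδ hR hco).congr hEeq
  have hcm : ∀ p, coef lam p * moment e p * (p.factorial : ℂ) = lam p := by
    intro p
    have h1 : moment e p ≠ 0 := norm_pos_iff.1 (hmom0 p)
    have h2 : (p.factorial : ℂ) ≠ 0 := by exact_mod_cast p.factorial_ne_zero
    simp only [coef]
    field_simp
  have hrem : ∀ N, ∀ z ∈ sector δ,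
      ‖E lam z - ∑ p ∈ Finset.range N, coef lam p * moment e p * z ^ p‖ ≤
        2 * (A / c) * (2 * Real.pi * (1 + M (N + 2))) / R ^ N * ‖z‖ ^ N := by
    intro N z hz
    rw [hEeq hz]
    exact he.norm_tsum_sub_le hδ0 hδ hR hco N hz
  have hQ : ∀ N, 0 ≤ 2 * (A / c) * (2 * Real.pi * (1 + M (N + 2))) / R ^ N := by
    intro N
    have := (hMpos (N + 2)).le
    positivity
  have hcauchy : ∀ N p, ∀ z ∈ sector γ, _ := fun N p z hz =>
    norm_iteratedDeriv_sub_le (isOpen_sector hδ) hdiff (hQ N) (hrem N) hε hε1 hz.1 (hball z hz) p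
  refine ⟨hdiff.mono (sector_mono hγδ.le), fun z hz p => ?_, fun p => ?_⟩
  · have h1 := hcauchy p p z hz
    rw [iteratedDeriv_sum_range_self, sub_zero] at h1
    have hzn : 0 < ‖z‖ := norm_pos_iff.2 hz.1
    refine h1.trans ?_
    calc _ = (p.factorial : ℝ) * (2 * (A / c) * (2 * Real.pi)) * (2 / (R * ε)) ^ p *
            (1 + M (p + 2)) := by
          simp only [div_pow, mul_pow]
          field_simp
      _ ≤ (p.factorial : ℝ) * (2 * (A / c) * (2 * Real.pi)) * (2 / (R * ε)) ^ p *
            (D ^ (p + 1) * M p) := by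
          gcongr
          exact hgrowth p
      _ = _ := by
          rw [hMhat]
          field_simp
          ring
  · rw [tendsto_iff_norm_sub_tendsto_zero]
    have hlim : Filter.Tendsto (fun z : ℂ => (p.factorial : ℝ) *
        (2 * (A / c) * (2 * Real.pi * (1 + M (p + 1 + 2))) / R ^ (p + 1)) * 2 ^ (p + 1) / ε ^ p *
          ‖z‖) (nhdsWithin 0 (sector γ)) (nhds 0) := by
      have := (continuous_norm (E := ℂ)).tendsto 0
      rw [norm_zero] at this
      simpa using (this.mono_left nhdsWithin_le_nhds).const_mul ((p.factorial : ℝ) *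
        (2 * (A / c) * (2 * Real.pi * (1 + M (p + 1 + 2))) / R ^ (p + 1)) * 2 ^ (p + 1) / ε ^ p)
    refine squeeze_zero' (Filter.Eventually.of_forall fun z => norm_nonneg _) ?_ hlim
    filter_upwards [self_mem_nhdsWithin] with z hz
    have h1 := hcauchy (p + 1) p z hz
    rw [iteratedDeriv_sum_range_succ, hcm] at h1
    have hzn : 0 < ‖z‖ := norm_pos_iff.2 hz.1
    refine h1.trans_eq ?_
    simp only [mul_pow, pow_succ ‖z‖]
    field_simp

end IsKernel

/-! ### Canonical products with positive coefficients -/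

lemma one_le_norm_one_add_mul {a : ℝ} (ha : 0 ≤ a) {w : ℂ} (hw : 0 ≤ w.re) :
    1 ≤ ‖1 + (a : ℂ) * w‖ := by
  refine le_trans ?_ (Complex.re_le_norm _)
  simp only [Complex.add_re, Complex.one_re, Complex.re_ofReal_mul]
  linarith [mul_nonneg ha hw]

lemma mul_norm_le_norm_one_add_mul {a : ℝ} (ha : 0 ≤ a) {w : ℂ} (hw : 0 ≤ w.re) :
    a * ‖w‖ ≤ ‖1 + (a : ℂ) * w‖ := by
  refine le_of_sq_le_sq ?_ (norm_nonneg _)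
  rw [mul_pow, Complex.sq_norm, Complex.sq_norm, Complex.normSq_apply, Complex.normSq_apply]
  simp only [Complex.add_re, Complex.one_re, Complex.re_ofReal_mul, Complex.add_im, Complex.one_im,
    Complex.im_ofReal_mul]
  nlinarith [mul_nonneg ha hw]

lemma exists_canonicalProduct {a : ℕ → ℝ} (ha : ∀ k, 0 ≤ a k) (hs : Summable a) :
    ∃ P : ℂ → ℂ, Differentiable ℂ P ∧ (∀ w : ℂ, 0 ≤ w.re → 1 ≤ ‖P w‖) ∧
      (∀ w : ℂ, 0 ≤ w.re → ∀ n, (∏ k ∈ Finset.range n, a k) * ‖w‖ ^ n ≤ ‖P w‖) ∧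
      (∀ x : ℝ, 0 ≤ x → ∀ L : ℝ, (∀ n, ∏ k ∈ Finset.range n, (1 + a k * x) ≤ L) →
        ∃ y ∈ Set.Icc 1 L, P x = (y : ℂ)) ∧
      (∀ x : ℝ, 0 ≤ x → ∃ y : ℝ, P x = (y : ℂ)) := by
  set P : ℂ → ℂ := fun w => ∏' k, (1 + (a k : ℂ) * w) with hP
  have hloc : ∀ r : ℝ, TendstoLocallyUniformlyOn
      (fun N w => ∏ k ∈ Finset.range N, (1 + (a k : ℂ) * w)) P atTop (Metric.ball 0 r) := by
    intro r
    refine HasProdLocallyUniformlyOn.tendstoLocallyUniformlyOn_finsetRange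
      (Summable.hasProdLocallyUniformlyOn_nat_one_add Metric.isOpen_ball (hs.mul_right r) ?_ ?_)
    · refine Filter.Eventually.of_forall fun n w hw => ?_
      rw [norm_mul, Complex.norm_real, Real.norm_eq_abs, abs_of_nonneg (ha n)]
      exact mul_le_mul_of_nonneg_left (mem_ball_zero_iff.1 hw).le (ha n)
    · intro n
      fun_prop
  have hmem : ∀ w : ℂ, w ∈ Metric.ball (0 : ℂ) (‖w‖ + 1) := fun w => by simp
  have hdiff : Differentiable ℂ P := fun w =>
    ((hloc (‖w‖ + 1)).differentiableOn (Filter.Eventually.of_forall fun N => by fun_prop)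
      Metric.isOpen_ball).differentiableAt (Metric.isOpen_ball.mem_nhds (hmem w))
  have hlim : ∀ w, Filter.Tendsto (fun N => ∏ k ∈ Finset.range N, (1 + (a k : ℂ) * w)) atTop
      (nhds (P w)) := fun w => (hloc (‖w‖ + 1)).tendsto_at (hmem w)
  have hlow : ∀ w : ℂ, 0 ≤ w.re → ∀ n, ∏ k ∈ Finset.range n, ‖1 + (a k : ℂ) * w‖ ≤ ‖P w‖ := by
    intro w hw n
    refine ge_of_tendsto (hlim w).norm ?_
    filter_upwards [eventually_ge_atTop n] with N hN
    rw [norm_prod, ← Finset.prod_range_mul_prod_Ico _ hN]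
    refine le_mul_of_one_le_right (Finset.prod_nonneg fun k _ => norm_nonneg _) ?_
    exact Finset.one_le_prod fun k _ => one_le_norm_one_add_mul (ha k) hw
  have hreal : ∀ x : ℝ, ∀ N, ∏ k ∈ Finset.range N, (1 + (a k : ℂ) * (x : ℂ)) =
      ((∏ k ∈ Finset.range N, (1 + a k * x) : ℝ) : ℂ) := by
    intro x N
    push_cast
    rfl
  refine ⟨P, hdiff, fun w hw => by simpa using hlow w hw 0, fun w hw n => ?_,
    fun x hx L hL => ?_, fun x hx => ?_⟩
  · refine le_trans ?_ (hlow w hw n)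
    calc _ = ∏ k ∈ Finset.range n, (a k * ‖w‖) := by
          rw [Finset.prod_mul_distrib, Finset.prod_const, Finset.card_range]
      _ ≤ _ := Finset.prod_le_prod (fun k _ => mul_nonneg (ha k) (norm_nonneg _))
          fun k _ => mul_norm_le_norm_one_add_mul (ha k) hw
  · have hclosed : IsClosed (Complex.ofReal '' Set.Icc 1 L) :=
      (isCompact_Icc.image Complex.continuous_ofReal).isClosed
    have := hclosed.mem_of_tendsto (hlim x) (Filter.Eventually.of_forall fun N => by
      rw [hreal]
      refine Set.mem_image_of_mem _ ⟨?_, hL N⟩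
      exact Finset.one_le_prod fun k _ => by linarith [mul_nonneg (ha k) hx])
    obtain ⟨y, hy, hyx⟩ := this
    exact ⟨y, hy, hyx.symm⟩
  · have hclosed : IsClosed (Set.range Complex.ofReal) :=
      Complex.isometry_ofReal.isClosedEmbedding.isClosed_range
    obtain ⟨y, hy⟩ := hclosed.mem_of_tendsto (hlim x) (Filter.Eventually.of_forall fun N => by
      rw [hreal]
      exact Set.mem_range_self _)
    exact ⟨y, hy.symm⟩

/-! ### Tails of convergent `p`-series -/

lemma sub_one_mul_rpow_add_rpow_le {r x : ℝ} (hr : 1 < r) (hx : 1 < x) :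
    (r - 1) * x ^ (-r) + x ^ (1 - r) ≤ (x - 1) ^ (1 - r) := by
  have hx0 : 0 < x := by linarith
  have hy : 0 < 1 - 1 / x := by
    rw [sub_pos, div_lt_one hx0]
    exact hx
  have h1 : x - 1 = x * (1 - 1 / x) := by field_simp
  have h2 : (1 - 1 / x) ^ (1 - r) ≥ 1 + (r - 1) / x := by
    rw [Real.rpow_def_of_pos hy]
    have hlog := Real.log_le_sub_one_of_pos hy
    have : (r - 1) / x ≤ Real.log (1 - 1 / x) * (1 - r) := by
      have : (r - 1) * (1 / x) ≤ (r - 1) * (-Real.log (1 - 1 / x)) := by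
        apply mul_le_mul_of_nonneg_left <;> linarith
      rw [div_eq_mul_one_div]
      linarith
    linarith [Real.add_one_le_exp (Real.log (1 - 1 / x) * (1 - r))]
  have h3 : x ^ (-r) = x ^ (1 - r) / x := by
    rw [show -r = 1 - r - 1 by ring, Real.rpow_sub_one hx0.ne']
  rw [h1, Real.mul_rpow hx0.le hy.le, h3]
  calc _ = x ^ (1 - r) * (1 + (r - 1) / x) := by ring
    _ ≤ _ := by gcongr

lemma sum_range_div_rpow_le {r : ℝ} (hr : 1 < r) (n : ℕ) (hn : 0 < n) (m : ℕ) :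
    ∑ j ∈ Finset.range m, ((n : ℝ) / (n + 1 + j)) ^ r ≤ n / (r - 1) := by
  have hn' : (0 : ℝ) < n := by exact_mod_cast hn
  have hn1 : (1 : ℝ) ≤ n := by exact_mod_cast hn
  have key : (r - 1) * ∑ j ∈ Finset.range m, ((n : ℝ) + 1 + j) ^ (-r) + ((n : ℝ) + m) ^ (1 - r) ≤
      (n : ℝ) ^ (1 - r) := by
    induction m with
    | zero => simp
    | succ m ih =>
      have h := sub_one_mul_rpow_add_rpow_le hr (x := (n : ℝ) + 1 + m) (by
        have := m.cast_nonneg (α := ℝ)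
        linarith)
      rw [show (n : ℝ) + 1 + m - 1 = n + m by ring] at h
      rw [Finset.sum_range_succ, mul_add]
      push_cast
      rw [show (n : ℝ) + (m + 1) = n + 1 + m by ring]
      linarith
  have hr1 : 0 < r - 1 := by linarith
  have h0 : (0 : ℝ) ≤ ((n : ℝ) + m) ^ (1 - r) := by positivity
  rw [le_div_iff₀ hr1]
  calc (∑ j ∈ Finset.range m, ((n : ℝ) / (n + 1 + j)) ^ r) * (r - 1)
      = (n : ℝ) ^ r * ((r - 1) * ∑ j ∈ Finset.range m, ((n : ℝ) + 1 + j) ^ (-r)) := by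
        have : ∀ j : ℕ, ((n : ℝ) / (n + 1 + j)) ^ r = n ^ r * ((n : ℝ) + 1 + j) ^ (-r) := fun j => by
          rw [Real.div_rpow hn'.le (by positivity), Real.rpow_neg (by positivity), div_eq_mul_inv]
        simp only [this, ← Finset.mul_sum]
        ring
    _ ≤ (n : ℝ) ^ r * (n : ℝ) ^ (1 - r) := by
        gcongr
        linarith
    _ = n := by
        rw [← Real.rpow_add hn']
        simp


/-! ### Construction of a kernel with prescribed decay -/

lemma prod_one_add_rpow_le {μ : ℕ → ℝ} (hμ : ∀ k, 0 < μ k) {b s C H : ℝ} (hb : 0 < b) (hs : 0 < s)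
    (hbs : 1 < b * s) (hC : 1 ≤ C) (hH : 1 ≤ H)
    (hreg : ∀ p k, p ≤ k → μ p * (((k : ℝ) + 1) / (p + 1)) ^ b ≤ C * μ k)
    (hroot : ∀ p, μ p ^ (p + 1) ≤ H ^ (p + 1) * ∏ k ∈ Finset.range (p + 1), μ k) (p n : ℕ) :
    ∏ k ∈ Finset.range n, (1 + μ k ^ (-s) * μ p ^ s) ≤
      (2 * C ^ s * H ^ s * Real.exp (C ^ s / (b * s - 1))) ^ (p + 1) := by
  have hC0 : 0 < C := by linarith
  have hH0 : 0 < H := by linarith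
  have hCs : 1 ≤ C ^ s := Real.one_le_rpow hC hs.le
  have hx : ∀ k, μ k ^ (-s) * μ p ^ s = (μ p / μ k) ^ s := fun k => by
    rw [Real.div_rpow (hμ p).le (hμ k).le, Real.rpow_neg (hμ k).le, div_eq_mul_inv, mul_comm]
  simp only [hx]
  have hpos : ∀ k, 0 < (μ p / μ k) ^ s := fun k => Real.rpow_pos_of_pos (div_pos (hμ p) (hμ k)) s
  have hsplit : ∏ k ∈ Finset.range n, (1 + (μ p / μ k) ^ s) ≤
      (∏ k ∈ Finset.range (p + 1), (1 + (μ p / μ k) ^ s)) *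
        ∏ j ∈ Finset.range n, (1 + (μ p / μ (p + 1 + j)) ^ s) := by
    rw [← Finset.prod_range_add, ← Finset.prod_range_mul_prod_Ico _ (Nat.le_add_left n (p + 1))]
    refine le_mul_of_one_le_right (Finset.prod_nonneg fun k _ => ?_)
      (Finset.one_le_prod fun k _ => ?_)
    · linarith [hpos k]
    · linarith [hpos k]
  have hhead : ∏ k ∈ Finset.range (p + 1), (1 + (μ p / μ k) ^ s) ≤ (2 * C ^ s * H ^ s) ^ (p + 1) := by
    calc _ ≤ ∏ k ∈ Finset.range (p + 1), (2 * C ^ s * (μ p / μ k) ^ s) := by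
          refine Finset.prod_le_prod (fun k _ => by linarith [hpos k]) fun k hk => ?_
          have hkp : k ≤ p := Nat.lt_succ_iff.1 (Finset.mem_range.1 hk)
          have h1 : (1 : ℝ) ≤ (((p : ℝ) + 1) / (k + 1)) ^ b := by
            refine Real.one_le_rpow ?_ hb.le
            rw [one_le_div (by positivity)]
            have : (k : ℝ) ≤ p := by exact_mod_cast hkp
            linarith
          have h2 : 1 ≤ C * (μ p / μ k) := by
            rw [← mul_div_assoc, one_le_div (hμ k)]
            exact (le_mul_of_one_le_right (hμ k).le h1).trans (hreg k p hkp)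
          have h3 : 1 ≤ C ^ s * (μ p / μ k) ^ s := by
            rw [← Real.mul_rpow hC0.le (div_pos (hμ p) (hμ k)).le]
            exact Real.one_le_rpow h2 hs.le
          nlinarith [hpos k]
      _ = (2 * C ^ s) ^ (p + 1) * (∏ k ∈ Finset.range (p + 1), (μ p / μ k)) ^ s := by
          rw [Finset.prod_mul_distrib, Finset.prod_const, Finset.card_range,
            Real.finsetProd_rpow _ _ fun k _ => (div_pos (hμ p) (hμ k)).le]
      _ ≤ (2 * C ^ s) ^ (p + 1) * (H ^ (p + 1)) ^ s := by
          have hpr : 0 < ∏ k ∈ Finset.range (p + 1), μ k := Finset.prod_pos fun k _ => hμ k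
          gcongr
          · exact Finset.prod_nonneg fun k _ => (div_pos (hμ p) (hμ k)).le
          · rw [Finset.prod_div_distrib, Finset.prod_const, Finset.card_range, div_le_iff₀ hpr]
            exact hroot p
      _ = _ := by
          rw [mul_pow (2 * C ^ s), ← Real.rpow_natCast H, ← Real.rpow_natCast (H ^ s),
            ← Real.rpow_mul hH0.le, ← Real.rpow_mul hH0.le, mul_comm s]
  have htail : ∏ j ∈ Finset.range n, (1 + (μ p / μ (p + 1 + j)) ^ s) ≤
      Real.exp (C ^ s / (b * s - 1)) ^ (p + 1) := by
    have hterm : ∀ j, (μ p / μ (p + 1 + j)) ^ s ≤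
        C ^ s * ((((p + 1 : ℕ) : ℝ)) / ((p + 1 : ℕ) + 1 + j)) ^ (b * s) := by
      intro j
      have h1 := hreg p (p + 1 + j) (by omega)
      have hpos1 : (0 : ℝ) < ((p + 1 : ℕ) : ℝ) / ((p + 1 : ℕ) + 1 + j) := by positivity
      rw [Real.rpow_mul hpos1.le, ← Real.mul_rpow hC0.le (Real.rpow_nonneg hpos1.le _)]
      refine Real.rpow_le_rpow (div_pos (hμ p) (hμ _)).le ?_ hs.le
      rw [div_le_iff₀ (hμ _)]
      have h2 : (((p + 1 + j : ℕ) : ℝ) + 1) / (p + 1) =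
          (((p + 1 : ℕ) : ℝ) / ((p + 1 : ℕ) + 1 + j))⁻¹ := by
        push_cast
        rw [inv_div]
        ring
      rw [h2, Real.inv_rpow hpos1.le, ← div_eq_mul_inv,
        div_le_iff₀ (Real.rpow_pos_of_pos hpos1 _)] at h1
      linarith
    calc _ ≤ ∏ j ∈ Finset.range n, Real.exp ((μ p / μ (p + 1 + j)) ^ s) := by
          refine Finset.prod_le_prod (fun k _ => by linarith [hpos (p + 1 + k)]) fun k _ => ?_
          rw [add_comm]
          exact Real.add_one_le_exp _
      _ = Real.exp (∑ j ∈ Finset.range n, (μ p / μ (p + 1 + j)) ^ s) := (Real.exp_sum _ _).symm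
      _ ≤ Real.exp (((p + 1 : ℕ) : ℝ) * (C ^ s / (b * s - 1))) := by
          refine Real.exp_le_exp.2 ((Finset.sum_le_sum fun j _ => hterm j).trans ?_)
          rw [← Finset.mul_sum]
          refine (mul_le_mul_of_nonneg_left
            (sum_range_div_rpow_le hbs (p + 1) p.succ_pos n) (by linarith)).trans_eq ?_
          ring
      _ = _ := by rw [Real.exp_nat_mul]
  refine hsplit.trans ?_
  rw [mul_pow _ (Real.exp _)]
  refine mul_le_mul hhead htail (Finset.prod_nonneg fun k _ => ?_) (by positivity)
  linarith [hpos (p + 1 + k)]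

lemma summable_rpow_neg_of_regular {μ : ℕ → ℝ} (hμ : ∀ k, 0 < μ k) {b s C : ℝ} (hs : 0 < s)
    (hbs : 1 < b * s) (hC : 1 ≤ C)
    (hreg : ∀ k : ℕ, μ 0 * ((k : ℝ) + 1) ^ b ≤ C * μ k) :
    Summable fun k => μ k ^ (-s) := by
  have hC0 : 0 < C := by linarith
  have hsum : Summable fun k : ℕ => (C / μ 0) ^ s * ((k + 1 : ℕ) : ℝ) ^ (-(b * s)) :=
    (((Real.summable_nat_rpow (p := -(b * s))).2 (by linarith)).comp_injective
      (add_left_injective 1)).mul_left _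
  refine hsum.of_nonneg_of_le (fun k => Real.rpow_nonneg (hμ k).le _) fun k => ?_
  have hk : (0 : ℝ) < (k : ℝ) + 1 := by positivity
  have hkb := Real.rpow_pos_of_pos hk b
  push_cast
  rw [Real.rpow_neg hk.le, Real.rpow_mul hk.le, ← div_eq_mul_inv,
    ← Real.div_rpow (div_pos hC0 (hμ 0)).le hkb.le, Real.rpow_neg (hμ k).le,
    ← Real.inv_rpow (hμ k).le]
  refine Real.rpow_le_rpow (inv_pos.2 (hμ k)).le ?_ hs.le
  rw [div_div, inv_le_comm₀ (hμ k) (div_pos hC0 (mul_pos (hμ 0) hkb)), inv_div,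
    div_le_iff₀ hC0]
  linarith [hreg k]

lemma IsKernel.le_norm_moment {δ : ℝ} {M : ℕ → ℝ} {e : ℂ → ℂ} (he : IsKernel δ M e)
    (hδ0 : 0 < δ) (hδ : δ ≤ 2) (hre : ∀ t : ℝ, 0 < t → 0 ≤ (e t).re) {q T : ℝ} (hT : 0 < T)
    (hq : ∀ t : ℝ, 0 < t → t ≤ T → q ≤ (e t).re) (p : ℕ) :
    q * (T ^ (p + 1) / (p + 1)) ≤ ‖moment e p‖ := by
  have hone : (1 : ℂ) ∈ sector δ := by
    have := ofReal_mem_sector hδ0 one_pos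
    rwa [Complex.ofReal_one] at this
  have hInt : IntegrableOn (fun u : ℝ => e u * (u : ℂ) ^ p) (Ioi 0) := by
    simpa using he.integrableOn hδ0 hδ hone p
  refine le_trans ?_ (Complex.re_le_norm _)
  have hre_eq : (moment e p).re = ∫ u in Ioi (0 : ℝ), (e u).re * u ^ p := by
    rw [moment, ← RCLike.re_eq_complex_re, ← integral_re hInt]
    refine integral_congr_ae (Filter.Eventually.of_forall fun u => ?_)
    simp only [RCLike.re_eq_complex_re]
    rw [← Complex.ofReal_pow, Complex.re_mul_ofReal]
  have hInt_re : IntegrableOn (fun u : ℝ => (e u).re * u ^ p) (Ioi 0) := by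
    refine hInt.re.congr (Filter.Eventually.of_forall fun u => ?_)
    simp only [RCLike.re_eq_complex_re]
    rw [← Complex.ofReal_pow, Complex.re_mul_ofReal]
  rw [hre_eq]
  calc q * (T ^ (p + 1) / (p + 1)) = ∫ u in Ioc 0 T, q * u ^ p := by
        rw [← intervalIntegral.integral_of_le hT.le, intervalIntegral.integral_const_mul,
          integral_pow]
        simp
    _ ≤ ∫ u in Ioc 0 T, (e u).re * u ^ p := by
        refine setIntegral_mono_on ?_ (hInt_re.mono_set Ioc_subset_Ioi_self) measurableSet_Ioc
          fun u hu => mul_le_mul_of_nonneg_right (hq u hu.1 hu.2) (pow_nonneg hu.1.le p)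
        exact (Continuous.integrableOn_Icc (by fun_prop)).mono_set Ioc_subset_Icc_self
    _ ≤ _ := by
        refine setIntegral_mono_set hInt_re ?_ (Ioc_subset_Ioi_self).eventuallyLE
        filter_upwards [ae_restrict_mem measurableSet_Ioi] with u hu
        exact mul_nonneg (hre u hu) (pow_nonneg (le_of_lt hu) p)

lemma exists_isKernel {M : ℕ → ℝ} {δ b C H : ℝ} (hδ0 : 0 < δ) (hδ2 : δ ≤ 2) (hδb : δ < b)
    (hM : ∀ p, 0 < M p) (hM0 : M 0 = 1) (hC : 1 ≤ C) (hH : 1 ≤ H)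
    (hreg : ∀ p k, p ≤ k → M (p + 1) / M p * (((k : ℝ) + 1) / (p + 1)) ^ b ≤
      C * (M (k + 1) / M k))
    (hroot : ∀ p, (M (p + 1) / M p) ^ (p + 1) ≤ H ^ (p + 1) * M (p + 1)) :
    ∃ e, IsKernel δ M e ∧ ∃ c > 0, ∀ p, c ^ (p + 1) * M p ≤ ‖moment e p‖ := by
  set μ : ℕ → ℝ := fun k => M (k + 1) / M k with hμ_def
  set s : ℝ := 1 / δ with hs_def
  have hμ : ∀ k, 0 < μ k := fun k => div_pos (hM _) (hM _)
  have hb : 0 < b := hδ0.trans hδb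
  have hs : 0 < s := one_div_pos.2 hδ0
  have hs2 : 1 ≤ s * 2 := by
    rw [hs_def, div_mul_eq_mul_div, one_mul, one_le_div hδ0]
    exact hδ2
  have hbs : 1 < b * s := by
    rw [hs_def, mul_one_div, one_lt_div hδ0]
    exact hδb
  have hprod : ∀ n, ∏ k ∈ Finset.range n, μ k = M n := fun n => by
    induction n with
    | zero => simp [hM0]
    | succ n ih => rw [Finset.prod_range_succ, ih, mul_div_cancel₀ _ (hM n).ne']
  have hC0 : 0 < C := by linarith
  obtain ⟨P, hPdiff, hP1, hPpow, hPle, hPreal⟩ := exists_canonicalProduct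
    (a := fun k => μ k ^ (-s)) (fun k => Real.rpow_nonneg (hμ k).le _)
    (summable_rpow_neg_of_regular hμ hs hbs hC fun k => by simpa using hreg 0 k k.zero_le)
  have hre : ∀ ζ ∈ sector δ, 0 ≤ (ζ ^ (s : ℂ)).re := by
    intro ζ hζ
    rw [Complex.cpow_ofReal_re]
    refine mul_nonneg (Real.rpow_nonneg (norm_nonneg _) _) (Real.cos_nonneg_of_mem_Icc ?_)
    have h1 : |Complex.arg ζ * s| ≤ Real.pi / 2 := by
      rw [abs_mul, abs_of_pos hs, hs_def, mul_one_div, div_le_iff₀ hδ0]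
      linarith [hζ.2]
    exact ⟨by linarith [(abs_le.1 h1).1], (abs_le.1 h1).2⟩
  have hPne : ∀ ζ ∈ sector δ, P (ζ ^ (s : ℂ)) ≠ 0 := fun ζ hζ h0 => by
    have := hP1 _ (hre ζ hζ)
    rw [h0, norm_zero] at this
    linarith
  set e : ℂ → ℂ := fun ζ => ((P (ζ ^ (s : ℂ)))⁻¹) ^ 2 with he_def
  have hnorm : ∀ ζ, ‖e ζ‖ = (‖P (ζ ^ (s : ℂ))‖⁻¹) ^ 2 := fun ζ => by
    simp only [he_def, norm_pow, norm_inv]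
  have hle1 : ∀ ζ ∈ sector δ, ‖e ζ‖ ≤ 1 := fun ζ hζ => by
    rw [hnorm]
    exact pow_le_one₀ (by positivity) (inv_le_one_of_one_le₀ (hP1 _ (hre ζ hζ)))
  have hker : IsKernel δ M e := by
    refine ⟨fun ζ hζ => ?_, hle1, fun ζ hζ n => ?_⟩
    · have h1 : DifferentiableAt ℂ (fun ζ : ℂ => ζ ^ (s : ℂ)) ζ :=
        differentiableAt_id.cpow_const (sector_subset_slitPlane hδ2 hζ)
      exact (((hPdiff _).comp ζ h1).inv (hPne ζ hζ) |>.pow 2).differentiableWithinAt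
    · rcases le_total (‖ζ‖ ^ n) (M n) with hn | hn
      · calc _ ≤ 1 * ‖ζ‖ ^ n := by gcongr; exact hle1 ζ hζ
          _ ≤ M n := by linarith
      · have hζn : 0 < ‖ζ‖ ^ n := (hM n).trans_le hn
        have hQ : 1 ≤ ‖ζ‖ ^ n / M n := (one_le_div (hM n)).2 hn
        have h1 : (‖ζ‖ ^ n / M n) ^ s ≤ ‖P (ζ ^ (s : ℂ))‖ := by
          refine le_trans (le_of_eq ?_) (hPpow _ (hre ζ hζ) n)
          rw [Real.finsetProd_rpow _ _ fun k _ => (hμ k).le, hprod, Complex.norm_cpow_real,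
            Real.div_rpow hζn.le (hM n).le, Real.rpow_neg (hM n).le, ← Real.rpow_natCast,
            ← Real.rpow_natCast, ← Real.rpow_mul (norm_nonneg _), ← Real.rpow_mul (norm_nonneg _),
            div_eq_mul_inv, mul_comm, mul_comm s]
        have h2 : ‖ζ‖ ^ n / M n ≤ ‖P (ζ ^ (s : ℂ))‖ ^ 2 := by
          calc _ = (‖ζ‖ ^ n / M n) ^ (1 : ℝ) := (Real.rpow_one _).symm
            _ ≤ (‖ζ‖ ^ n / M n) ^ (s * (2 : ℕ)) :=
                Real.rpow_le_rpow_of_exponent_le hQ (by exact_mod_cast hs2)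
            _ = ((‖ζ‖ ^ n / M n) ^ s) ^ 2 := Real.rpow_mul_natCast (by positivity) _ _
            _ ≤ _ := by gcongr
        have hP0 : 0 < ‖P (ζ ^ (s : ℂ))‖ ^ 2 := by
          have := hP1 _ (hre ζ hζ)
          positivity
        rw [hnorm, inv_pow, inv_mul_le_iff₀ hP0]
        rwa [div_le_iff₀ (hM n)] at h2
  have hereal : ∀ t : ℝ, 0 < t → ∀ y : ℝ, P ((t ^ s : ℝ) : ℂ) = y → (e t).re = (y⁻¹) ^ 2 := by
    intro t ht y hy
    rw [Complex.ofReal_cpow ht.le] at hy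
    simp only [he_def, hy]
    rw [← Complex.ofReal_inv, ← Complex.ofReal_pow, Complex.ofReal_re]
  refine ⟨e, hker, ?_⟩
  set L : ℝ := 2 * C ^ s * H ^ s * Real.exp (C ^ s / (b * s - 1)) with hL
  have hL0 : 0 < L := by positivity
  have hmom : ∀ p, ((L ^ (p + 1))⁻¹) ^ 2 * (μ p ^ (p + 1) / (p + 1)) ≤ ‖moment e p‖ := by
    intro p
    refine hker.le_norm_moment hδ0 hδ2 (fun t ht => ?_) (hμ p) (fun t ht htμ => ?_) p
    · obtain ⟨y, hy⟩ := hPreal (t ^ s) (by positivity)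
      rw [hereal t ht y hy]
      positivity
    · obtain ⟨y, hy, hPy⟩ := hPle (t ^ s) (by positivity) (L ^ (p + 1)) fun n => by
        refine le_trans (Finset.prod_le_prod (fun k _ => ?_) fun k _ => ?_)
          (prod_one_add_rpow_le hμ hb hs hbs hC hH hreg (fun p => by rw [hprod]; exact hroot p) p n)
        · have := Real.rpow_nonneg (hμ k).le (-s)
          positivity
        · have := Real.rpow_nonneg (hμ k).le (-s)
          gcongr
      rw [hereal t ht y hPy]
      have : 0 < y := by linarith [hy.1]
      gcongr
      exact hy.2
  set κ : ℝ := min 1 (μ 0 / C) with hκ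
  have hκ0 : 0 < κ := lt_min one_pos (div_pos (hμ 0) hC0)
  have hμp : ∀ k p, k ≤ p → μ k ≤ C * μ p := by
    intro k p hkp
    refine (le_mul_of_one_le_right (hμ k).le ?_).trans (hreg k p hkp)
    refine Real.one_le_rpow ?_ hb.le
    rw [one_le_div (by positivity)]
    have : (k : ℝ) ≤ p := by exact_mod_cast hkp
    linarith
  refine ⟨κ / (2 * C * L ^ 2), by positivity, fun p => le_trans ?_ (hmom p)⟩
  have h1 : M (p + 1) ≤ C ^ (p + 1) * μ p ^ (p + 1) := by
    calc M (p + 1) = ∏ k ∈ Finset.range (p + 1), μ k := (hprod _).symm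
      _ ≤ ∏ _k ∈ Finset.range (p + 1), C * μ p := Finset.prod_le_prod (fun k _ => (hμ k).le)
          fun k hk => hμp k p (Nat.lt_succ_iff.1 (Finset.mem_range.1 hk))
      _ = _ := by rw [Finset.prod_const, Finset.card_range, mul_pow]
  have h2 : κ * M p ≤ M (p + 1) := by
    have : κ ≤ μ p := (min_le_right _ _).trans ((div_le_iff₀' hC0).2 (hμp 0 p p.zero_le))
    calc κ * M p ≤ μ p * M p := by gcongr; exact (hM p).le
      _ = M (p + 1) := div_mul_cancel₀ _ (hM p).ne'
  have h3 : ((p : ℝ) + 1) ≤ 2 ^ (p + 1) := by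
    have : p + 1 < 2 ^ (p + 1) := Nat.lt_two_pow_self
    exact_mod_cast this.le
  have h4 : κ ^ (p + 1) ≤ κ := pow_le_of_le_one hκ0.le (min_le_left _ _) p.succ_ne_zero
  have h5 : κ ^ (p + 1) * M p ≤ C ^ (p + 1) * μ p ^ (p + 1) :=
    (mul_le_mul_of_nonneg_right h4 (hM p).le).trans (h2.trans h1)
  rw [div_pow, mul_pow, mul_pow, inv_pow, ← pow_mul, ← pow_mul, mul_comm 2 (p + 1),
    div_mul_eq_mul_div, div_le_iff₀ (by positivity)]
  have hLp : 0 < L ^ ((p + 1) * 2) := by positivity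
  calc κ ^ (p + 1) * M p ≤ C ^ (p + 1) * μ p ^ (p + 1) := h5
    _ ≤ C ^ (p + 1) * μ p ^ (p + 1) * (2 ^ (p + 1) / (p + 1)) := by
        refine le_mul_of_one_le_right ?_ ?_
        · have := hμ p
          positivity
        · rwa [one_le_div (by positivity)]
    _ = _ := by field_simp

/-! ### From `Mhat = p! M` to the hypotheses of the kernel construction -/

lemma regular_of_factorial {M Mhat : ℕ → ℝ} (hMhat : ∀ p, Mhat p = p.factorial * M p)
    (hM : ∀ p, 0 < M p) {D a : ℝ}
    (hreg : ∀ p k : ℕ, p ≤ k →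
      Mhat (p + 1) / Mhat p * (((k : ℝ) + 1) / (p + 1)) ^ a ≤ D * (Mhat (k + 1) / Mhat k))
    (p k : ℕ) (hpk : p ≤ k) :
    M (p + 1) / M p * (((k : ℝ) + 1) / (p + 1)) ^ (a - 1) ≤ D * (M (k + 1) / M k) := by
  have hq : ∀ k, Mhat (k + 1) / Mhat k = (k + 1) * (M (k + 1) / M k) := fun k => by
    have := hM k
    have hk : (0 : ℝ) < k.factorial := by exact_mod_cast k.factorial_pos
    rw [hMhat, hMhat, Nat.factorial_succ]
    push_cast
    field_simp
  have h := hreg p k hpk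
  rw [hq, hq] at h
  have hR : (0 : ℝ) < ((k : ℝ) + 1) / (p + 1) := by positivity
  have hk : (0 : ℝ) < (k : ℝ) + 1 := by positivity
  rw [Real.rpow_sub_one hR.ne']
  refine le_of_mul_le_mul_left (le_of_eq_of_le ?_ (h.trans_eq ?_)) hk
  · field_simp
  · ring

lemma pow_quotient_le_of_factorial {M Mhat : ℕ → ℝ} (hMhat : ∀ p, Mhat p = p.factorial * M p)
    (hM : ∀ p, 0 < M p) (hLC : LCseq Mhat) {C : ℝ} (hC : 1 ≤ C)
    (hmg : ∀ j k : ℕ, Mhat (j + k) ≤ C ^ (j + k) * Mhat j * Mhat k) (p : ℕ) :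
    (M (p + 1) / M p) ^ (p + 1) ≤ (C ^ 2) ^ (p + 1) * M (p + 1) := by
  have hq : Mhat (p + 1) / Mhat p = (p + 1) * (M (p + 1) / M p) := by
    have := hM p
    have hk : (0 : ℝ) < p.factorial := by exact_mod_cast p.factorial_pos
    rw [hMhat, hMhat, Nat.factorial_succ]
    push_cast
    field_simp
  have h := hLC.pow_quotient_le hmg p (p + 1)
  rw [hq, mul_pow, hMhat] at h
  have hp : (0 : ℝ) < ((p : ℝ) + 1) ^ (p + 1) := by positivity
  have hfac : ((p + 1).factorial : ℝ) ≤ ((p : ℝ) + 1) ^ (p + 1) := by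
    exact_mod_cast Nat.factorial_le_pow (p + 1)
  have hM1 := hM (p + 1)
  refine le_of_mul_le_mul_left (h.trans ?_) hp
  calc C ^ (p + (p + 1)) * ((p + 1).factorial * M (p + 1))
      ≤ C ^ (2 * (p + 1)) * (((p : ℝ) + 1) ^ (p + 1) * M (p + 1)) := by
        gcongr
        · omega
    _ = _ := by
        rw [pow_mul]
        ring

lemma exists_one_add_le_of_factorial {M Mhat : ℕ → ℝ}
    (hMhat : ∀ p, Mhat p = p.factorial * M p) (hM : ∀ p, 0 < M p) (hM0 : M 0 = 1)
    {b C D : ℝ} (hb : 0 < b) (hC : 1 ≤ C) (hD : 1 ≤ D)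
    (hmg : ∀ j k : ℕ, Mhat (j + k) ≤ C ^ (j + k) * Mhat j * Mhat k)
    (hreg : ∀ k : ℕ, M 1 / M 0 * ((k : ℝ) + 1) ^ b ≤ D * (M (k + 1) / M k)) :
    ∃ B > 0, ∀ p, 1 + M (p + 2) ≤ B ^ (p + 1) * M p := by
  have hD0 : 0 < D := by linarith
  set κ : ℝ := min 1 (M 1 / D) with hκ
  have hκ0 : 0 < κ := lt_min one_pos (div_pos (hM 1) hD0)
  have hlow : ∀ p, κ ^ p ≤ M p := by
    intro p
    induction p with
    | zero => simp [hM0]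
    | succ p ih =>
      have h1 : κ ≤ M (p + 1) / M p := by
        refine (min_le_right _ _).trans ((div_le_iff₀' hD0).2 ?_)
        have h2 := hreg p
        rw [hM0, div_one] at h2
        refine (le_mul_of_one_le_right (hM 1).le (Real.one_le_rpow ?_ hb.le)).trans h2
        linarith [p.cast_nonneg (α := ℝ)]
      rw [le_div_iff₀ (hM p)] at h1
      calc κ ^ (p + 1) = κ * κ ^ p := pow_succ' _ _
        _ ≤ κ * M p := by gcongr
        _ ≤ M (p + 1) := h1
  have hup : ∀ p, M (p + 2) ≤ C ^ (p + 2) * Mhat 2 * M p := by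
    intro p
    have h := hmg p 2
    rw [hMhat (p + 2), hMhat p] at h
    have hf : (0 : ℝ) < p.factorial := by exact_mod_cast p.factorial_pos
    have hf2 : (p.factorial : ℝ) ≤ (p + 2).factorial := by
      exact_mod_cast Nat.factorial_le (Nat.le_add_right p 2)
    refine le_of_mul_le_mul_left ?_ hf
    calc (p.factorial : ℝ) * M (p + 2) ≤ (p + 2).factorial * M (p + 2) :=
          mul_le_mul_of_nonneg_right hf2 (hM _).le
      _ ≤ _ := h
      _ = _ := by ring
  have hN2 : 0 ≤ Mhat 2 := by
    rw [hMhat]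
    exact mul_nonneg (Nat.cast_nonneg _) (hM 2).le
  set x := κ⁻¹ with hx_def
  set y := C ^ 2 * (1 + Mhat 2) with hy_def
  have hx : 1 ≤ x := (one_le_inv₀ hκ0).2 (min_le_left _ _)
  have hy : 1 ≤ y := one_le_mul_of_one_le_of_one_le (one_le_pow₀ hC) (by linarith)
  refine ⟨2 * (x * y), by positivity, fun p => ?_⟩
  have hMp := hM p
  have h1 : 1 ≤ x ^ (p + 1) * M p := by
    calc (1 : ℝ) = x ^ p * κ ^ p := by rw [← mul_pow, hx_def, inv_mul_cancel₀ hκ0.ne', one_pow]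
      _ ≤ x ^ (p + 1) * M p := by
        gcongr
        · omega
        · exact hlow p
  have h2 : M (p + 2) ≤ y ^ (p + 1) * M p := by
    refine (hup p).trans (mul_le_mul_of_nonneg_right ?_ hMp.le)
    rw [hy_def, mul_pow, ← pow_mul]
    refine mul_le_mul (pow_le_pow_right₀ hC (by omega)) ?_ hN2 (by positivity)
    exact (le_add_of_nonneg_left zero_le_one).trans (le_self_pow₀ (by linarith) p.succ_ne_zero)
  have hxy : x ^ (p + 1) + y ^ (p + 1) ≤ (2 * (x * y)) ^ (p + 1) := by
    have hx1 : 1 ≤ x ^ (p + 1) := one_le_pow₀ hx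
    have hy1 : 1 ≤ y ^ (p + 1) := one_le_pow₀ hy
    have h2p : (2 : ℝ) ≤ 2 ^ (p + 1) := le_self_pow₀ one_le_two p.succ_ne_zero
    rw [mul_pow 2, mul_pow x]
    calc x ^ (p + 1) + y ^ (p + 1) ≤ 2 * (x ^ (p + 1) * y ^ (p + 1)) := by nlinarith
      _ ≤ _ := by gcongr
  calc 1 + M (p + 2) ≤ (x ^ (p + 1) + y ^ (p + 1)) * M p := by linarith
    _ ≤ _ := by gcongr

lemma exists_pcond_of_lt_gammaIndex {ω : ℝ → ℝ} {γ : ℝ} (hγ0 : 0 < γ)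
    (h : ENNReal.ofReal γ < gammaIndex ω - 1) : ∃ a, γ + 1 < a ∧ Pcond ω a := by
  have h1 : ENNReal.ofReal γ + 1 < gammaIndex ω := lt_tsub_iff_right.1 h
  rw [gammaIndex, lt_iSup_iff] at h1
  obtain ⟨a, h1⟩ := h1
  rw [lt_iSup_iff] at h1
  obtain ⟨⟨_, hPa⟩, h1⟩ := h1
  refine ⟨a, ?_, hPa⟩
  rw [← ENNReal.ofReal_one, ← ENNReal.ofReal_add hγ0.le zero_le_one] at h1
  exact (ENNReal.ofReal_lt_ofReal_iff_of_nonneg (by positivity)).1 h1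

end RoumieuExtension

/-- Roumieu extension theorem, weight-sequence case:
for `M̂ = (p! M_p)_p ∈ LC` with moderate growth and `γ(ω_{M̂}) > 1`, existence of a
continuous linear extension operator `Λ¹_{M̂,h} → A_{M̂,h₁}(S_γ)`; in particular the
Borel map on the Roumieu class is surjective. -/
theorem roumieu_extension_weight_sequence
    (M : ℕ → ℝ) (Mhat : ℕ → ℝ)
    (hMhat : ∀ p : ℕ, Mhat p = (Nat.factorial p : ℝ) * M p)
    (hLC : LCseq Mhat)
    (hmg : ∃ C : ℝ, 1 ≤ C ∧ ∀ j k : ℕ, Mhat (j + k) ≤ C ^ (j + k) * Mhat j * Mhat k)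
    (hγω : 1 < gammaIndex (assocWeight Mhat))
    (γ : ℝ) (hγ0 : 0 < γ)
    (hγ : ENNReal.ofReal γ < min 2 (gammaIndex (assocWeight Mhat) - 1))
    (h : ℝ) (hh : 0 < h) :
    (∃ h₁ : ℝ, 0 < h₁ ∧
      ∃ E : (ℕ → ℂ) →ₗ[ℂ] (ℂ → ℂ), ∃ C : ℝ, 0 ≤ C ∧
        ∀ lam : ℕ → ℂ, ∀ A : ℝ,
          (∀ p : ℕ, ‖lam p‖ ≤ A * h ^ p * Mhat p) →
          DifferentiableOn ℂ (E lam) (sector γ) ∧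
          (∀ z ∈ sector γ, ∀ p : ℕ,
            ‖iteratedDeriv p (E lam) z‖ ≤ C * A * h₁ ^ p * Mhat p) ∧
          (∀ p : ℕ, Filter.Tendsto (iteratedDeriv p (E lam))
            (nhdsWithin 0 (sector γ)) (nhds (lam p)))) ∧
    (∀ lam : ℕ → ℂ,
      (∃ h' : ℝ, 0 < h' ∧ ∃ A : ℝ, ∀ p : ℕ, ‖lam p‖ ≤ A * h' ^ p * Mhat p) →
      ∃ f : ℂ → ℂ, DifferentiableOn ℂ f (sector γ) ∧
        (∃ h'' : ℝ, 0 < h'' ∧ ∃ C : ℝ, ∀ z ∈ sector γ, ∀ p : ℕ,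
          ‖iteratedDeriv p f z‖ ≤ C * h'' ^ p * Mhat p) ∧
        (∀ p : ℕ, Filter.Tendsto (iteratedDeriv p f)
          (nhdsWithin 0 (sector γ)) (nhds (lam p)))) := by
  obtain ⟨C, hC, hmg⟩ := hmg
  have hfac : ∀ p : ℕ, (0 : ℝ) < p.factorial := fun p => by exact_mod_cast p.factorial_pos
  have hM : ∀ p, 0 < M p := fun p => by
    have := hLC.pos p
    rw [hMhat] at this
    exact pos_of_mul_pos_right this (hfac p).le
  have hM0 : M 0 = 1 := by simpa [hMhat] using hLC.2.1
  have hγ2 : γ < 2 := by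
    have := hγ.trans_le (min_le_left _ _)
    rw [← ENNReal.ofReal_ofNat] at this
    exact (ENNReal.ofReal_lt_ofReal_iff two_pos).1 this
  obtain ⟨a, hγa, hPa⟩ :=
    RoumieuExtension.exists_pcond_of_lt_gammaIndex hγ0 (hγ.trans_le (min_le_right _ _))
  obtain ⟨D, hD, hregN⟩ := hLC.exists_quotient_regular hC hmg (by linarith) hPa
  have hreg := RoumieuExtension.regular_of_factorial hMhat hM hregN
  obtain ⟨δ, hγδ, hδ⟩ := exists_between (lt_min (show γ < a - 1 by linarith) hγ2)
  have hδ0 : 0 < δ := hγ0.trans hγδ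
  have hδ2 : δ ≤ 2 := (hδ.trans_le (min_le_right _ _)).le
  obtain ⟨e, he, c, hc, hmom⟩ := RoumieuExtension.exists_isKernel hδ0 hδ2
    (hδ.trans_le (min_le_left _ _)) hM hM0 hD (one_le_pow₀ hC) hreg
    (RoumieuExtension.pow_quotient_le_of_factorial hMhat hM hLC hC hmg)
  obtain ⟨B, hB, hgrowth⟩ := RoumieuExtension.exists_one_add_le_of_factorial hMhat hM hM0
    (show 0 < a - 1 by linarith) hC hD hmg fun k => by simpa using hreg 0 k k.zero_le
  refine ⟨he.exists_extension hγ0 hγδ hδ2 hM hc hB hmom hgrowth hMhat hh, ?_⟩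
  rintro lam ⟨h', hh', A, hA⟩
  obtain ⟨h₁, hh₁, E, K, _, hE⟩ :=
    he.exists_extension hγ0 hγδ hδ2 hM hc hB hmom hgrowth hMhat hh'
  obtain ⟨hdiff, hbound, hlim⟩ := hE lam A hA
  exact ⟨E lam, hdiff, ⟨h₁, hh₁, K * A, hbound⟩, hlim⟩
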